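/- arXiv:math/0411074 — 3 statements merged into one kernel-verified Lean document; each statement's English description precedes it below -/
import Mathlib

section
/- For every δ ≥ 0 there exists λ > 0 such that every bounded open convex subset C of ℝ² whose Hilbert metric space (C, d_C) is δ-hyperbolic satisfies λ₁(C) ≥ λ. In particular, if (C, d_C) is Gromov hyperbolic then λ₁(C) > 0. -/
open MeasureTheory Set Filter
open scoped ENNReal NNReal

noncomputable section

/-- Euclidean `n`-space. -/
abbrev Euc (n : ℕ) : Type := EuclideanSpace ℝ (Fin n)

/-- The set of parameters `t` such that `p + t • v` lies in `C`. For `C` open bounded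
convex, `p ∈ C` and `v ≠ 0` this is an open interval `(t⁻, t⁺)` with `t⁻ < 0 < t⁺`;
the points `p + t⁻ • v` and `p + t⁺ • v` are the two intersections of the boundary `∂C`
with the line through `p` directed by `v`. -/
def lineParams {n : ℕ} (C : Set (Euc n)) (p v : Euc n) : Set ℝ := {t : ℝ | p + t • v ∈ C}

open Classical in
/-- The Hilbert distance of the convex set `C`: with `a = p + t⁻ • (q - p)` and
`b = p + t⁺ • (q - p)` the two boundary points (so that `a, p, q, b` are in this order),
the cross-ratio `(‖q-a‖ ‖p-b‖)/(‖p-a‖ ‖q-b‖)` equals `((1 - t⁻) t⁺)/((-t⁻)(t⁺ - 1))`. -/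
def hDist {n : ℕ} (C : Set (Euc n)) (p q : Euc n) : ℝ :=
  if p = q then 0
  else
    (1 / 2) * Real.log
      (((1 - sInf (lineParams C p (q - p))) * sSup (lineParams C p (q - p))) /
        ((-sInf (lineParams C p (q - p))) * (sSup (lineParams C p (q - p)) - 1)))

open Classical in
/-- The Hilbert Finsler norm of `u` at `p`: with `p⁺ = p + t⁺ • u`, `p⁻ = p + t⁻ • u`
the two boundary points on the line through `p` directed by `u`, one has
`(1/2)‖u‖(1/‖p-p⁺‖ + 1/‖p-p⁻‖) = (1/2)(1/t⁺ - 1/t⁻)`. -/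
def fNorm {n : ℕ} (C : Set (Euc n)) (p u : Euc n) : ℝ :=
  if u = 0 then 0
  else (1 / 2) * (1 / sSup (lineParams C p u) - 1 / sInf (lineParams C p u))

/-- The dual norm of a linear form `l` at `p`: `sup {l u : ‖u‖_{C,p} = 1}`. -/
def dualNorm {n : ℕ} (C : Set (Euc n)) (p : Euc n) (l : Euc n →L[ℝ] ℝ) : ℝ :=
  sSup ((fun u => l u) '' {u : Euc n | fNorm C p u = 1})

/-- The tangent ball `TB_R(p) = {u : ‖u‖_{C,p} < R}`. -/
def tangentBall {n : ℕ} (C : Set (Euc n)) (p : Euc n) (R : ℝ) : Set (Euc n) :=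
  {u : Euc n | fNorm C p u < R}

/-- `ωₙ`, the Lebesgue volume of the Euclidean unit ball of `ℝⁿ`. -/
def omegaVol (n : ℕ) : ℝ := (volume (Metric.ball (0 : Euc n) 1)).toReal

/-- The Hilbert (Busemann) measure of `C`: density `ωₙ / vol_e(TB_C(p))` against
Lebesgue measure, supported on `C`. -/
def hMeasure {n : ℕ} (C : Set (Euc n)) : Measure (Euc n) :=
  (volume.restrict C).withDensity fun p =>
    ENNReal.ofReal (omegaVol n / (volume (tangentBall C p 1)).toReal)

/-- Admissible test functions: nonzero Lipschitz functions with compact support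
contained in `Ω`. -/
def testFuns {n : ℕ} (Ω : Set (Euc n)) : Set (Euc n → ℝ) :=
  {f : Euc n → ℝ |
    (∃ K : ℝ≥0, LipschitzWith K f) ∧ f ≠ 0 ∧ HasCompactSupport f ∧ tsupport f ⊆ Ω}

/-- The Rayleigh quotient of `f` on `Ω`, with respect to the Hilbert geometry of `C`
(`df` is the a.e.-defined differential of the Lipschitz function `f`). -/
def rayleigh {n : ℕ} (C Ω : Set (Euc n)) (f : Euc n → ℝ) : ℝ :=
  (∫ p in Ω, dualNorm C p (fderiv ℝ f p) ^ 2 ∂hMeasure C) /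
    ∫ p in Ω, f p ^ 2 ∂hMeasure C

/-- The Dirichlet bottom of the spectrum `λ₁^C(Ω)`. -/
def lambda1D {n : ℕ} (C Ω : Set (Euc n)) : ℝ := sInf (rayleigh C Ω '' testFuns Ω)

/-- The bottom of the spectrum `λ₁(C)` of the Hilbert geometry of `C`. -/
def lambda1 {n : ℕ} (C : Set (Euc n)) : ℝ := lambda1D C C

/-- The Gromov product `(x|y)_t = (d(x,t) + d(y,t) - d(x,y))/2`. -/
def gromovProd {n : ℕ} (d : Euc n → Euc n → ℝ) (x y t : Euc n) : ℝ :=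
  (d x t + d y t - d x y) / 2

/-- `(C, d_C)` is `δ`-hyperbolic: for all `x y z t` in `C`,
`(x|y)_t ≥ min((x|z)_t, (y|z)_t) - δ`. -/
def IsDeltaHyp {n : ℕ} (C : Set (Euc n)) (δ : ℝ) : Prop :=
  ∀ x ∈ C, ∀ y ∈ C, ∀ z ∈ C, ∀ t ∈ C,
    gromovProd (hDist C) x y t ≥
      min (gromovProd (hDist C) x z t) (gromovProd (hDist C) y z t) - δ

/-- The metric ball `B_R(x)` of the Hilbert metric of `C`. -/
def hBall {n : ℕ} (C : Set (Euc n)) (x : Euc n) (R : ℝ) : Set (Euc n) :=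
  {y ∈ C | hDist C x y < R}

/-- The image of `C` under the homothety of center `P₀` and ratio `r`. -/
def homoth {n : ℕ} (P₀ : Euc n) (r : ℝ) (C : Set (Euc n)) : Set (Euc n) :=
  (fun x => P₀ + r • (x - P₀)) '' C

/-- Diameter of a set with respect to a distance function `d`. -/
def ediamD {α : Type*} (d : α → α → ℝ) (S : Set α) : ℝ≥0∞ :=
  ⨆ x ∈ S, ⨆ y ∈ S, ENNReal.ofReal (d x y)

/-- The `k`-dimensional Hausdorff measure of `S` with respect to the distance
function `d`. -/
def hausD {α : Type*} (k : ℝ) (d : α → α → ℝ) (S : Set α) : ℝ≥0∞ :=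
  ⨆ (ε : ℝ≥0∞) (_ : 0 < ε),
    ⨅ (U : ℕ → Set α) (_ : S ⊆ ⋃ i, U i) (_ : ∀ i, ediamD d (U i) ≤ ε),
      ∑' i, ediamD d (U i) ^ k

/-- The frontier of `U` is a rectifiable closed curve (for the Hilbert metric of `C`):
it is the image of a closed continuous curve and has finite one-dimensional Hausdorff
measure. -/
def RectCurveBoundary (C U : Set (Euc 2)) : Prop :=
  ∃ c : ℝ → Euc 2, ContinuousOn c (Icc 0 1) ∧ c '' Icc (0 : ℝ) 1 = frontier U ∧
    c 0 = c 1 ∧ hausD 1 (hDist C) (frontier U) < ⊤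

/-- The Cheeger constant `I_∞^C(Ω)` in dimension `2`: infimum of
`ν_C(∂U)/μ_C(U)` over open sets `U` with closure contained in `Ω` whose boundary is a
rectifiable curve, `ν_C` being the `1`-dimensional Hausdorff measure of `(C, d_C)`. -/
def cheeger2D (C Ω : Set (Euc 2)) : ℝ :=
  sInf {r : ℝ | ∃ U : Set (Euc 2), IsOpen U ∧ U.Nonempty ∧ closure U ⊆ Ω ∧
    RectCurveBoundary C U ∧
    r = (hausD 1 (hDist C) (frontier U)).toReal / (hMeasure C U).toReal}

/-- The Cheeger constant `I_∞(C)` of a planar Hilbert geometry. -/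
def cheeger2 (C : Set (Euc 2)) : ℝ := cheeger2D C C

/-- `S` is a `C¹` hypersurface: near each of its points it is the zero set of a `C¹`
function with nonvanishing differential. -/
def IsC1Hypersurface {n : ℕ} (S : Set (Euc n)) : Prop :=
  ∀ x ∈ S, ∃ (f : Euc n → ℝ) (U : Set (Euc n)), U ∈ nhds x ∧ ContDiffOn ℝ 1 f U ∧
    (∀ y ∈ U, fderiv ℝ f y ≠ 0) ∧ S ∩ U = {y ∈ U | f y = 0}

/-- The Cheeger constant `I_∞^C(Ω)` in dimension `n`: infimum of `ν_C(∂U)/μ_C(U)` over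
open sets `U` with closure contained in `Ω` whose boundary is a `C¹` hypersurface,
`ν_C` being the `(n-1)`-dimensional Hausdorff measure of `(C, d_C)`. -/
def cheegerND {n : ℕ} (C Ω : Set (Euc n)) : ℝ :=
  sInf {r : ℝ | ∃ U : Set (Euc n), IsOpen U ∧ U.Nonempty ∧ closure U ⊆ Ω ∧
    IsC1Hypersurface (frontier U) ∧
    r = (hausD ((n : ℝ) - 1) (hDist C) (frontier U)).toReal / (hMeasure C U).toReal}

/-- The boundary of the convex set `C` is of class `C¹`: through each boundary point
passes a unique supporting hyperplane. -/
def HasC1Boundary {n : ℕ} (C : Set (Euc n)) : Prop :=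
  ∀ x ∈ frontier C, ∃! l : Euc n →L[ℝ] ℝ, ‖l‖ = 1 ∧ ∀ y ∈ C, l y ≤ l x

/-- The convex set `C` is strictly convex: the open segment joining two distinct
boundary points is contained in `C`. -/
def IsStrictlyConvexSet {n : ℕ} (C : Set (Euc n)) : Prop :=
  ∀ x ∈ frontier C, ∀ y ∈ frontier C, x ≠ y → openSegment ℝ x y ⊆ C

end




/-- bounded open convex -/
structure BOC {n : ℕ} (C : Set (Euc n)) : Prop where
  cvx : Convex ℝ C
  opn : IsOpen C
  bdd : Bornology.IsBounded C

namespace BOC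
variable {n : ℕ} {C : Set (Euc n)}

lemma lp_open (hC : BOC C) (p u : Euc n) : IsOpen (lineParams C p u) := by
  have : Continuous (fun t : ℝ => p + t • u) := by fun_prop
  exact hC.opn.preimage this

lemma lp_bdd (hC : BOC C) {p u : Euc n} (hu : u ≠ 0) :
    Bornology.IsBounded (lineParams C p u) := by
  obtain ⟨R, hR⟩ := hC.bdd.exists_norm_le
  have hun : 0 < ‖u‖ := norm_pos_iff.mpr hu
  refine isBounded_iff_forall_norm_le.mpr ⟨(R + ‖p‖) / ‖u‖, fun t ht => ?_⟩
  have h1 := hR _ ht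
  have h2 : ‖t • u‖ ≤ ‖p + t • u‖ + ‖p‖ := by
    have := norm_sub_le (p + t • u) p
    simpa using this
  rw [norm_smul] at h2
  rw [le_div_iff₀ hun]
  linarith

lemma lp_conn (hC : BOC C) (p u : Euc n) : IsPreconnected (lineParams C p u) := by
  have : Convex ℝ (lineParams C p u) := by
    intro s hs t ht a b ha hb hab
    have := hC.cvx hs ht ha hb hab
    have e : a • (p + s • u) + b • (p + t • u) = p + (a • s + b • t) • u := by
      have : a = 1 - b := by linarith
      subst this
      simp only [smul_eq_mul]
      module
    rw [e] at this
    exact this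
  exact this.isPreconnected

lemma lp_zero {p u : Euc n} (hp : p ∈ C) : (0:ℝ) ∈ lineParams C p u := by
  simpa [lineParams] using hp

lemma lt_sSup (hC : BOC C) {p u : Euc n} (hu : u ≠ 0) {t : ℝ} (ht : p + t • u ∈ C) :
    t < sSup (lineParams C p u) := by
  obtain ⟨e, he, h⟩ := Metric.isOpen_iff.mp (hC.lp_open p u) t ht
  have : t + e / 2 ∈ lineParams C p u := h (by simp [abs_of_pos he, he])
  have := le_csSup (hC.lp_bdd hu).bddAbove this
  linarith

lemma sInf_lt (hC : BOC C) {p u : Euc n} (hu : u ≠ 0) {t : ℝ} (ht : p + t • u ∈ C) :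
    sInf (lineParams C p u) < t := by
  obtain ⟨e, he, h⟩ := Metric.isOpen_iff.mp (hC.lp_open p u) t ht
  have : t - e / 2 ∈ lineParams C p u := h (by simp [abs_of_pos he, he])
  have := csInf_le (hC.lp_bdd hu).bddBelow this
  linarith

lemma mem_of_lt (hC : BOC C) {p u : Euc n} (hu : u ≠ 0) {t : ℝ}
    (h1 : sInf (lineParams C p u) < t) (h2 : t < sSup (lineParams C p u)) : p + t • u ∈ C := by
  have hne : (lineParams C p u).Nonempty := by
    by_contra h
    rw [not_nonempty_iff_eq_empty] at h
    rw [h, Real.sInf_empty] at h1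
    rw [h, Real.sSup_empty] at h2
    linarith
  exact IsConnected.Ioo_csInf_csSup_subset ⟨hne, hC.lp_conn p u⟩ (hC.lp_bdd hu).bddBelow (hC.lp_bdd hu).bddAbove ⟨h1, h2⟩

lemma sSup_pos (hC : BOC C) {p u : Euc n} (hp : p ∈ C) (hu : u ≠ 0) :
    0 < sSup (lineParams C p u) := hC.lt_sSup hu (lp_zero hp)

lemma sInf_neg (hC : BOC C) {p u : Euc n} (hp : p ∈ C) (hu : u ≠ 0) :
    sInf (lineParams C p u) < 0 := hC.sInf_lt hu (lp_zero hp)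

lemma sSup_le (hC : BOC C) {p u : Euc n} (hp : p ∈ C) (hu : u ≠ 0) {t : ℝ} (h0 : 0 ≤ t)
    (ht : p + t • u ∉ C) : sSup (lineParams C p u) ≤ t := by
  by_contra h
  push Not at h
  exact ht (hC.mem_of_lt hu ((hC.sInf_neg hp hu).trans_le h0) h)

lemma le_sInf (hC : BOC C) {p u : Euc n} (hp : p ∈ C) (hu : u ≠ 0) {t : ℝ} (h0 : t ≤ 0)
    (ht : p + t • u ∉ C) : t ≤ sInf (lineParams C p u) := by
  by_contra h
  push Not at h
  exact ht (hC.mem_of_lt hu h (h0.trans_lt (hC.sSup_pos hp hu)))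

lemma hDist_le (hC : BOC C) {p q : Euc n} (hpq : p ≠ q) {α β : ℝ} (hα : 0 < α) (hβ : 0 < β)
    (h1 : p + (-α) • (q - p) ∈ C) (h2 : p + (1 + β) • (q - p) ∈ C) :
    hDist C p q ≤ 1 / 2 * Real.log ((1 + α) / α * ((1 + β) / β)) := by
  have hu : q - p ≠ 0 := sub_ne_zero.mpr hpq.symm
  have a1 := hC.sInf_lt hu h1
  have a2 := hC.lt_sSup hu h2
  rw [hDist, if_neg hpq]
  set a := sInf (lineParams C p (q - p))
  set b := sSup (lineParams C p (q - p))
  have e : ((1 - a) * b) / ((-a) * (b - 1)) = (1 - a) / (-a) * (b / (b - 1)) := by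
    rw [div_mul_div_comm]
  rw [e]
  have hna : 0 < -a := by linarith
  have hb1 : 0 < b - 1 := by linarith
  have k1 : (1 - a) / (-a) ≤ (1 + α) / α := by
    rw [div_le_div_iff₀ hna hα]; nlinarith
  have k2 : b / (b - 1) ≤ (1 + β) / β := by
    rw [div_le_div_iff₀ hb1 hβ]; nlinarith
  have k3 : 0 < (1 - a) / (-a) := div_pos (by linarith) hna
  have k4 : 0 < b / (b - 1) := div_pos (by linarith) hb1
  have := Real.log_le_log (mul_pos k3 k4) (mul_le_mul k1 k2 k4.le (k3.le.trans k1))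
  linarith

lemma hDist_ge (hC : BOC C) {p q : Euc n} (hp : p ∈ C) (hq : q ∈ C) (hpq : p ≠ q) {β : ℝ}
    (hβ : 0 < β)
    (h2 : p + (1 + β) • (q - p) ∉ C) :
    1 / 2 * Real.log ((1 + β) / β) ≤ hDist C p q := by
  have hu : q - p ≠ 0 := sub_ne_zero.mpr hpq.symm
  have a1 := hC.sInf_neg hp hu
  have a3 : 1 < sSup (lineParams C p (q - p)) := hC.lt_sSup hu (by simpa using hq)
  have a2 := hC.sSup_le hp hu (by linarith) h2
  rw [hDist, if_neg hpq]
  set a := sInf (lineParams C p (q - p))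
  set b := sSup (lineParams C p (q - p))
  have e : ((1 - a) * b) / ((-a) * (b - 1)) = (1 - a) / (-a) * (b / (b - 1)) := by
    rw [div_mul_div_comm]
  rw [e]
  have hna : 0 < -a := by linarith
  have hb1 : 0 < b - 1 := by linarith
  have k1 : 1 ≤ (1 - a) / (-a) := by
    rw [le_div_iff₀ hna]; linarith
  have k2 : (1 + β) / β ≤ b / (b - 1) := by
    rw [div_le_div_iff₀ hβ hb1]; nlinarith
  have k3 : 0 < (1 + β) / β := by positivity
  have := Real.log_le_log k3 (by nlinarith : (1 + β) / β ≤ (1 - a) / (-a) * (b / (b - 1)))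
  linarith

lemma hDist_ge2 (hC : BOC C) {p q : Euc n} (hp : p ∈ C) (hq : q ∈ C) (hpq : p ≠ q) {α β : ℝ}
    (hα : 0 < α) (hβ : 0 < β)
    (h1 : p + (-α) • (q - p) ∉ C) (h2 : p + (1 + β) • (q - p) ∉ C) :
    1 / 2 * Real.log ((1 + α) / α * ((1 + β) / β)) ≤ hDist C p q := by
  have hu : q - p ≠ 0 := sub_ne_zero.mpr hpq.symm
  have a1 := hC.sInf_neg hp hu
  have a3 : 1 < sSup (lineParams C p (q - p)) := hC.lt_sSup hu (by simpa using hq)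
  have a2 := hC.sSup_le hp hu (by linarith) h2
  have a4 := hC.le_sInf hp hu (by linarith) h1
  rw [hDist, if_neg hpq]
  set a := sInf (lineParams C p (q - p))
  set b := sSup (lineParams C p (q - p))
  have e : ((1 - a) * b) / ((-a) * (b - 1)) = (1 - a) / (-a) * (b / (b - 1)) := by
    rw [div_mul_div_comm]
  rw [e]
  have hna : 0 < -a := by linarith
  have hb1 : 0 < b - 1 := by linarith
  have k1 : (1 + α) / α ≤ (1 - a) / (-a) := by
    rw [div_le_div_iff₀ hα hna]; nlinarith
  have k2 : (1 + β) / β ≤ b / (b - 1) := by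
    rw [div_le_div_iff₀ hβ hb1]; nlinarith
  have k3 : 0 < (1 + β) / β := by positivity
  have k4 : 0 < (1 + α) / α := by positivity
  have := Real.log_le_log (mul_pos k4 k3) (mul_le_mul k1 k2 k3.le (k4.le.trans k1))
  linarith

lemma fNorm_pos (hC : BOC C) {p u : Euc n} (hp : p ∈ C) (hu : u ≠ 0) : 0 < fNorm C p u := by
  rw [fNorm, if_neg hu]
  have h1 := one_div_pos.mpr (hC.sSup_pos hp hu)
  have h2 := one_div_neg.mpr (hC.sInf_neg hp hu)
  linarith

lemma fNorm_nonneg (hC : BOC C) {p u : Euc n} (hp : p ∈ C) : 0 ≤ fNorm C p u := by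
  by_cases hu : u = 0
  · simp [fNorm, hu]
  · exact (hC.fNorm_pos hp hu).le

open scoped Pointwise in
lemma fNorm_smul {p u : Euc n} {c : ℝ} (hc : 0 < c) :
    fNorm C p (c • u) = c * fNorm C p u := by
  by_cases hu : u = 0
  · simp [fNorm, hu]
  rw [fNorm, fNorm, if_neg hu, if_neg (smul_ne_zero hc.ne' hu)]
  have e : lineParams C p (c • u) = c⁻¹ • lineParams C p u := by
    ext t
    rw [Set.mem_smul_set_iff_inv_smul_mem₀ (inv_ne_zero hc.ne')]
    simp only [lineParams, mem_setOf_eq, inv_inv, smul_eq_mul, smul_smul]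
    rw [mul_comm]
  rw [e, Real.sSup_smul_of_nonneg (inv_nonneg.mpr hc.le),
    Real.sInf_smul_of_nonneg (inv_nonneg.mpr hc.le)]
  simp only [smul_eq_mul, one_div, mul_inv, inv_inv]
  ring

/-- comparison -/
lemma fNorm_compare (hC : BOC C) {p q z : Euc n} (hp : p ∈ C) (hz : z ∈ C) {s : ℝ}
    (hs0 : 0 ≤ s) (hs1 : s < 1) (hq : q = (1 - s) • p + s • z) (u : Euc n) :
    (1 - s) * fNorm C q u ≤ fNorm C p u := by
  by_cases hu : u = 0
  · simp [fNorm, hu]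
  have hqC : q ∈ C := by
    rw [hq]; exact hC.cvx hp hz (by linarith) hs0 (by ring)
  have key : ∀ t, p + t • u ∈ C → q + ((1 - s) * t) • u ∈ C := by
    intro t ht
    have := hC.cvx ht hz (a := 1 - s) (b := s) (by linarith) hs0 (by ring)
    rw [hq]
    convert this using 1
    module
  have hs : 0 < 1 - s := by linarith
  have k1 : sSup (lineParams C p u) ≤ sSup (lineParams C q u) / (1 - s) := by
    refine csSup_le ⟨0, lp_zero hp⟩ fun t ht => ?_
    rw [le_div_iff₀ hs]
    have := hC.lt_sSup hu (key t ht)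
    linarith
  have k2 : sInf (lineParams C q u) / (1 - s) ≤ sInf (lineParams C p u) := by
    refine le_csInf ⟨0, lp_zero hp⟩ fun t ht => ?_
    rw [div_le_iff₀ hs]
    have := hC.sInf_lt hu (key t ht)
    linarith
  rw [fNorm, fNorm, if_neg hu, if_neg hu]
  have a1 := hC.sSup_pos hp hu
  have a2 := hC.sSup_pos hqC hu
  have b1 := hC.sInf_neg hp hu
  have b2 := hC.sInf_neg hqC hu
  set P := sSup (lineParams C p u)
  set Q := sSup (lineParams C q u)
  set P' := sInf (lineParams C p u)
  set Q' := sInf (lineParams C q u)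
  have l1 : (1 - s) / Q ≤ 1 / P := by
    rw [le_div_iff₀ hs] at k1
    rw [div_le_div_iff₀ a2 a1]; linarith
  have l2 : (1 - s) / (-Q') ≤ 1 / (-P') := by
    rw [div_le_iff₀ hs] at k2
    rw [div_le_div_iff₀ (by linarith) (by linarith)]; linarith
  rw [div_neg, div_neg] at l2
  have e : (1 - s) * (1 / 2 * (1 / Q - 1 / Q')) = 1/2 * ((1 - s) / Q - (1 - s) / Q') := by ring
  rw [e]
  linarith

lemma half_mem (hC : BOC C) {p u : Euc n} (hp : p ∈ C) (h : fNorm C p u ≤ 1) :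
    p + (1/3 : ℝ) • u ∈ C ∧ p - (1/3 : ℝ) • u ∈ C := by
  by_cases hu : u = 0
  · simp [hu, hp]
  rw [fNorm, if_neg hu] at h
  have a1 := hC.sSup_pos hp hu
  have b1 := hC.sInf_neg hp hu
  have c1 := one_div_pos.mpr a1
  have c2 := one_div_neg.mpr b1
  have d1 : 1/3 < sSup (lineParams C p u) := by
    have : 1 / sSup (lineParams C p u) ≤ 2 := by linarith
    rw [div_le_iff₀ a1] at this
    linarith
  have d2 : sInf (lineParams C p u) < -(1/3) := by
    have : 1 / (-sInf (lineParams C p u)) ≤ 2 := by rw [div_neg]; linarith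
    rw [div_le_iff₀ (by linarith)] at this
    linarith
  refine ⟨hC.mem_of_lt hu (by linarith) d1, ?_⟩
  have := hC.mem_of_lt hu d2 (by linarith)
  rwa [neg_smul, ← sub_eq_add_neg] at this

lemma half_mem' (hC : BOC C) {p u : Euc n} (hp : p ∈ C) (h : fNorm C p u < 1) :
    p + (1/2 : ℝ) • u ∈ C ∧ p - (1/2 : ℝ) • u ∈ C := by
  by_cases hu : u = 0
  · simp [hu, hp]
  rw [fNorm, if_neg hu] at h
  have a1 := hC.sSup_pos hp hu
  have b1 := hC.sInf_neg hp hu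
  have c1 := one_div_pos.mpr a1
  have c2 := one_div_neg.mpr b1
  have d1 : 1/2 < sSup (lineParams C p u) := by
    have : 1 / sSup (lineParams C p u) < 2 := by linarith
    rw [div_lt_iff₀ a1] at this
    linarith
  have d2 : sInf (lineParams C p u) < -(1/2) := by
    have : 1 / (-sInf (lineParams C p u)) < 2 := by rw [div_neg]; linarith
    rw [div_lt_iff₀ (by linarith)] at this
    linarith
  refine ⟨hC.mem_of_lt hu (by linarith) d1, ?_⟩
  have := hC.mem_of_lt hu d2 (by linarith)
  rwa [neg_smul, ← sub_eq_add_neg] at this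

lemma fNorm_lt_one (hC : BOC C) {p u : Euc n} (h1 : p + u ∈ C) (h2 : p - u ∈ C) :
    fNorm C p u < 1 := by
  by_cases hu : u = 0
  · simp [fNorm, hu]
  have a1 : 1 < sSup (lineParams C p u) := hC.lt_sSup hu (by simpa using h1)
  have a2 : sInf (lineParams C p u) < -1 := hC.sInf_lt hu (by simpa [← sub_eq_add_neg] using h2)
  rw [fNorm, if_neg hu]
  have d1 : 1 / sSup (lineParams C p u) < 1 := by
    rw [div_lt_iff₀ (by linarith)]; linarith
  have d2 : 1 / (-sInf (lineParams C p u)) < 1 := by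
    rw [div_lt_iff₀ (by linarith)]; linarith
  rw [div_neg] at d2
  linarith

lemma norm_le_diam (hC : BOC C) {p u : Euc n} (hp : p ∈ C) (h : fNorm C p u ≤ 1) :
    ‖u‖ ≤ 3 * Metric.diam C := by
  have h1 := (hC.half_mem hp h).1
  have := Metric.dist_le_diam_of_mem hC.bdd h1 hp
  rw [dist_eq_norm, add_sub_cancel_left, norm_smul] at this
  norm_num at this
  linarith

end BOC


/-- affine coordinates -/
def ptc {n : ℕ} (b h v : Euc n) (x y : ℝ) : Euc n := b + x • h + y • v

lemma ptc_line {n : ℕ} (b h v : Euc n) (x y x' y' s : ℝ) :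
    ptc b h v x y + s • (ptc b h v x' y' - ptc b h v x y) =
      ptc b h v (x + s * (x' - x)) (y + s * (y' - y)) := by
  unfold ptc; module

lemma ptc_combo {n : ℕ} {b h v : Euc n} {C : Set (Euc n)} (hC : BOC C) {x y x' y' : ℝ}
    (h1 : ptc b h v x y ∈ C) (h2 : ptc b h v x' y' ∈ C) {s : ℝ} (h0 : 0 ≤ s) (hs : s ≤ 1) :
    ptc b h v ((1 - s) * x + s * x') ((1 - s) * y + s * y') ∈ C := by
  have := hC.cvx h1 h2 (a := 1 - s) (b := s) (by linarith) h0 (by ring)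
  convert this using 1
  unfold ptc; module

lemma ptc_ne {n : ℕ} {b h v : Euc n} (hind : ∀ x y : ℝ, x • h + y • v = 0 → x = 0 ∧ y = 0)
    {x y x' y' : ℝ} (hne : x ≠ x' ∨ y ≠ y') : ptc b h v x y ≠ ptc b h v x' y' := by
  intro he
  have : (x - x') • h + (y - y') • v = 0 := by
    have : ptc b h v x y - ptc b h v x' y' = 0 := sub_eq_zero.mpr he
    rw [← this]; unfold ptc; module
  obtain ⟨h1, h2⟩ := hind _ _ this
  rcases hne with h | h
  · exact h (by linarith)
  · exact h (by linarith)

lemma ratio_aux {a r : ℝ} (ha : 0 < a) (hr : 0 < r) : (1 + a / r) / (a / r) = (r + a) / a := by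
  field_simp

set_option maxHeartbeats 2000000 in
lemma hyp_step {n : ℕ} {C : Set (Euc n)} (hC : BOC C) {δ : ℝ} (hδ : 0 ≤ δ) (hyp : IsDeltaHyp C δ)
    {κ : ℝ} (hκ : κ = Real.exp (-(4 * δ)) / 100) {b h v : Euc n}
    (hind : ∀ x y : ℝ, x • h + y • v = 0 → x = 0 ∧ y = 0)
    (hpos : ∀ x y, ptc b h v x y ∈ C → 0 < y) {l : ℝ}
    (hv : ∀ y, 0 < y → y < l → ptc b h v 0 y ∈ C)
    {x d m : ℝ} (hx : 0 < x) (hdm : d ≤ m) (hd : ptc b h v x d ∈ C)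
    (hl : 2 * (8 / κ ^ 2 * m) ≤ l) :
    ∃ d', d' ≤ 8 / κ ^ 2 * m ∧ ptc b h v ((1 + κ) * x) d' ∈ C := by
  by_contra hcon
  push Not at hcon
  have hd0 := hpos _ _ hd
  have hm : 0 < m := by linarith
  have hκ0 : 0 < κ := by rw [hκ]; positivity
  have hκ1 : κ ≤ 1/100 := by
    rw [hκ]
    have : Real.exp (-(4 * δ)) ≤ 1 := Real.exp_le_one_iff.mpr (by linarith)
    linarith
  -- η in units of m
  obtain ⟨E, hE⟩ : ∃ E, E = 4 / κ := ⟨_, rfl⟩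
  have hEκ : E * κ = 4 := by rw [hE]; field_simp
  have hE400 : 400 ≤ E := by nlinarith
  have hM : 8 / κ ^ 2 * m = 2 * E / κ * m := by rw [hE]; field_simp; norm_num
  have hMκ : 8 / κ ^ 2 * m * κ = 2 * E * m := by rw [hM]; field_simp
  have hlκ : 4 * E * m ≤ l * κ := by nlinarith
  have hbig : 200 * E * m ≤ 8 / κ ^ 2 * m := by
    have : 0 < 8 / κ ^ 2 * m := by positivity
    nlinarith
  obtain ⟨B, hB⟩ : ∃ B, B = 8 / κ ^ 2 * m := ⟨_, rfl⟩
  rw [← hB] at hbig hl hcon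
  have hEm : 400 * m ≤ E * m := by nlinarith
  have mem : ∀ θ y, 0 < θ → θ ≤ 1 → m ≤ y → y < θ * l → ptc b h v ((1 - θ) * x) y ∈ C := by
    intro θ y h0 h1 hy1 hy2
    have hlt : (1 - θ) * d < m := by nlinarith
    have := ptc_combo hC hd (hv ((y - (1 - θ) * d) / θ) (by apply div_pos _ h0; linarith)
      (by rw [div_lt_iff₀ h0]; nlinarith)) h0.le h1
    convert this using 1
    field_simp
    simp only [mul_zero, add_zero, add_sub_cancel]
  have half : ∀ y, m ≤ y → y ≤ 2 * (E * m) → ptc b h v (x / 2) y ∈ C := by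
    intro y h1 h2
    have := mem (1/2) y (by norm_num) (by norm_num) h1 (by linarith)
    rw [show (1 - 1/2 : ℝ) * x = x / 2 by ring] at this
    exact this
  have kap : ∀ y, m ≤ y → y ≤ 2 * (E * m) → ptc b h v ((1 - κ) * x) y ∈ C := fun y h1 h2 =>
    mem κ y hκ0 (by linarith) h1 (by nlinarith)
  have kap2 : ∀ y, m ≤ y → y ≤ E * m → ptc b h v ((1 - κ / 2) * x) y ∈ C := fun y h1 h2 =>
    mem (κ / 2) y (by linarith) (by linarith) h1 (by nlinarith)
  have zer : ∀ y, m ≤ y → y ≤ E * m → ptc b h v 0 y ∈ C := fun y h1 h2 =>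
    hv y (by linarith) (by linarith)
  have P1 := half (E * m) (by linarith) (by linarith)
  have Q1 := half (2 * m) (by linarith) (by linarith)
  have P2 := kap (E * m) (by linarith) (by linarith)
  have Q2 := kap (2 * m) (by linarith) (by linarith)
  have hΔ : 0 < E * m - 2 * m := by linarith
  have hΔ' : 0 < E - 2 := by linarith
  have hx12 : x / 2 ≠ (1 - κ) * x := by nlinarith
  have hyy : E * m ≠ 2 * m := by linarith
  have hk : 0 < 1/2 - κ := by linarith
  -- vertical
  have bV : (1 + E / (E - 2)) / (E / (E - 2)) * ((1 + 1 / (E - 2)) / (1 / (E - 2))) ≤ 2 * E := by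
    have : (1 + E / (E - 2)) / (E / (E - 2)) * ((1 + 1 / (E - 2)) / (1 / (E - 2)))
      = (2 * E - 2) * (E - 1) / E := by
      field_simp
      ring
    rw [this, div_le_iff₀ (by linarith)]
    nlinarith
  have bV0 : 0 < (1 + E / (E - 2)) / (E / (E - 2)) * ((1 + 1 / (E - 2)) / (1 / (E - 2))) := by
    have : 0 < E := by linarith
    positivity
  have s1 : hDist C (ptc b h v (x / 2) (E * m)) (ptc b h v (x / 2) (2 * m))
      ≤ 1 / 2 * Real.log (2 * E) := by
    refine (hC.hDist_le (ptc_ne hind (Or.inr hyy)) (α := E / (E - 2)) (β := 1 / (E - 2))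
      (div_pos (by linarith) hΔ') (by positivity) ?_ ?_).trans ?_
    · rw [ptc_line]
      convert half (2 * (E * m)) (by linarith) le_rfl using 2
      · ring
      · field_simp; ring
    · rw [ptc_line]
      convert half m le_rfl (by linarith) using 2
      · ring
      · field_simp; ring
    · have := Real.log_le_log bV0 bV
      linarith
  have s2 : hDist C (ptc b h v ((1 - κ) * x) (2 * m)) (ptc b h v ((1 - κ) * x) (E * m))
      ≤ 1 / 2 * Real.log (2 * E) := by
    refine (hC.hDist_le (ptc_ne hind (Or.inr hyy.symm)) (α := 1 / (E - 2)) (β := E / (E - 2))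
       (by positivity) (div_pos (by linarith) hΔ') ?_ ?_).trans ?_
    · rw [ptc_line]
      convert kap m le_rfl (by linarith) using 2
      · ring
      · field_simp; ring
    · rw [ptc_line]
      convert kap (2 * (E * m)) (by linarith) le_rfl using 2
      · ring
      · field_simp; ring
    · have := Real.log_le_log bV0 bV
      rw [mul_comm ((1 + 1 / (E - 2)) / (1 / (E - 2)))]
      linarith
  -- horizontal
  have bH : (1 + (1/2) / (1/2 - κ)) / ((1/2) / (1/2 - κ)) *
      ((1 + (κ/2) / (1/2 - κ)) / ((κ/2) / (1/2 - κ))) ≤ 2 / κ := by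
    have : (1 + (1/2) / (1/2 - κ)) / ((1/2) / (1/2 - κ)) *
      ((1 + (κ/2) / (1/2 - κ)) / ((κ/2) / (1/2 - κ)))
      = (2 * (1 - κ)) * (1 - κ) / κ := by
      rw [ratio_aux (by norm_num) hk, ratio_aux (by linarith) hk]
      field_simp
      ring
    rw [this]
    gcongr
    nlinarith
  have bH0 : 0 < (1 + (1/2) / (1/2 - κ)) / ((1/2) / (1/2 - κ)) *
      ((1 + (κ/2) / (1/2 - κ)) / ((κ/2) / (1/2 - κ))) := by
    positivity
  have s3 : hDist C (ptc b h v (x / 2) (E * m)) (ptc b h v ((1 - κ) * x) (E * m))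
      ≤ 1 / 2 * Real.log (2 / κ) := by
    refine (hC.hDist_le (ptc_ne hind (Or.inl hx12)) (α := (1/2) / (1/2 - κ))
      (β := (κ/2) / (1/2 - κ)) (by positivity) (by positivity) ?_ ?_).trans ?_
    · rw [ptc_line]
      convert zer (E * m) (by linarith) (by linarith) using 2
      · rw [show (1 - κ) * x - x / 2 = (1/2 - κ) * x by ring, ← mul_assoc, neg_mul,
          div_mul_cancel₀ _ hk.ne']; ring
      · ring
    · rw [ptc_line]
      convert kap2 (E * m) (by linarith) (by linarith) using 2
      · rw [show (1 - κ) * x - x / 2 = (1/2 - κ) * x by ring, ← mul_assoc, add_mul,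
          div_mul_cancel₀ _ hk.ne']; ring
      · ring
    · have := Real.log_le_log bH0 bH
      linarith
  have s4 : hDist C (ptc b h v ((1 - κ) * x) (2 * m)) (ptc b h v (x / 2) (2 * m))
      ≤ 1 / 2 * Real.log (2 / κ) := by
    refine (hC.hDist_le (ptc_ne hind (Or.inl hx12.symm)) (β := (1/2) / (1/2 - κ))
      (α := (κ/2) / (1/2 - κ)) (by positivity) (by positivity) ?_ ?_).trans ?_
    · rw [ptc_line]
      convert kap2 (2 * m) (by linarith) (by linarith) using 2
      · rw [show x / 2 - (1 - κ) * x = -((1/2 - κ) * x) by ring, neg_mul_neg, ← mul_assoc,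
          div_mul_cancel₀ _ hk.ne']; ring
      · ring
    · rw [ptc_line]
      convert zer (2 * m) (by linarith) (by linarith) using 2
      · rw [show x / 2 - (1 - κ) * x = -((1/2 - κ) * x) by ring, mul_neg, ← mul_assoc, add_mul,
          div_mul_cancel₀ _ hk.ne']; ring
      · ring
    · have := Real.log_le_log bH0 bH
      rw [mul_comm ((1 + (κ/2) / (1/2 - κ)) / ((κ/2) / (1/2 - κ)))]
      linarith
  -- lower bounds
  have eβ : (1 + 2 / (E - 2)) / (2 / (E - 2)) = 2 / κ := by
    have : E = 4 / κ := hE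
    have h2 : (1 + 2 / (E - 2)) / (2 / (E - 2)) = E / 2 := by field_simp; ring
    rw [h2, this]; field_simp; norm_num
  have s5 : 1 / 2 * Real.log (2 / κ) ≤
      hDist C (ptc b h v (x / 2) (E * m)) (ptc b h v ((1 - κ) * x) (2 * m)) := by
    rw [← eβ]
    refine hC.hDist_ge P1 Q2 (ptc_ne hind (Or.inl hx12)) (by positivity) ?_
    rw [ptc_line]
    intro hmem
    have := hpos _ _ hmem
    have e0 : E * m + (1 + 2 / (E - 2)) * (2 * m - E * m) = 0 := by field_simp; ring
    linarith
  have s6 : 1 / 2 * Real.log (1 / (4 * κ) * (2 / κ)) ≤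
      hDist C (ptc b h v ((1 - κ) * x) (E * m)) (ptc b h v (x / 2) (2 * m)) := by
    have hαp : 0 < (2 * κ) / (1/2 - κ) := by positivity
    have := hC.hDist_ge2 P2 Q1 (ptc_ne hind (Or.inl hx12.symm)) (α := (2 * κ) / (1/2 - κ))
      (β := 2 / (E - 2)) hαp (by positivity) ?_ ?_
    · refine le_trans ?_ this
      rw [eβ]
      have k1 : 1 / (4 * κ) ≤ (1 + 2 * κ / (1 / 2 - κ)) / (2 * κ / (1 / 2 - κ)) := by
        have : (1 + 2 * κ / (1 / 2 - κ)) / (2 * κ / (1 / 2 - κ)) = (1/2 + κ) / (2 * κ) := by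
          rw [ratio_aux (by linarith) hk]
          ring
        rw [this, div_le_div_iff₀ (by positivity) (by positivity)]
        nlinarith
      have k2 : 1 / (4 * κ) * (2 / κ) ≤ (1 + 2 * κ / (1 / 2 - κ)) / (2 * κ / (1 / 2 - κ)) * (2 / κ) := by
        gcongr
      have := Real.log_le_log (by positivity) k2
      linarith
    · rw [ptc_line]
      have e1 : (1 - κ) * x + -(2 * κ / (1 / 2 - κ)) * (x / 2 - (1 - κ) * x) = (1 + κ) * x := by
        rw [show x / 2 - (1 - κ) * x = -((1/2 - κ) * x) by ring, neg_mul_neg, ← mul_assoc,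
          div_mul_cancel₀ _ hk.ne']; ring
      rw [e1]
      apply hcon
      have : 2 * κ / (1 / 2 - κ) ≤ 1 := by
        rw [div_le_one hk]; linarith
      nlinarith
    · rw [ptc_line]
      intro hmem
      have := hpos _ _ hmem
      have e0 : E * m + (1 + 2 / (E - 2)) * (2 * m - E * m) = 0 := by field_simp; ring
      linarith
  have H := hyp _ P1 _ Q2 _ P2 _ Q1
  unfold gromovProd at H
  have hlog2 : Real.log (2 / κ) ≤ Real.log (2 * E) := by
    apply Real.log_le_log (by positivity)
    rw [div_le_iff₀ hκ0]; nlinarith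
  have hsum : Real.log (2 / κ) + Real.log (1 / (4 * κ) * (2 / κ)) ≤ 2 * Real.log (2 * E) + 4 * δ := by
    rcases min_choice ((hDist C (ptc b h v (x / 2) (E * m)) (ptc b h v (x / 2) (2 * m)) +
      hDist C (ptc b h v ((1 - κ) * x) (E * m)) (ptc b h v (x / 2) (2 * m)) -
      hDist C (ptc b h v (x / 2) (E * m)) (ptc b h v ((1 - κ) * x) (E * m))) / 2)
      ((hDist C (ptc b h v ((1 - κ) * x) (2 * m)) (ptc b h v (x / 2) (2 * m)) +
      hDist C (ptc b h v ((1 - κ) * x) (E * m)) (ptc b h v (x / 2) (2 * m)) -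
      hDist C (ptc b h v ((1 - κ) * x) (2 * m)) (ptc b h v ((1 - κ) * x) (E * m))) / 2) with hh | hh
    · rw [hh] at H; linarith
    · rw [hh] at H; linarith
  have hlk : Real.log κ = -(4 * δ) - Real.log 100 := by
    rw [hκ, Real.log_div (Real.exp_pos _).ne' (by norm_num), Real.log_exp]
  have l1 : Real.log (2 / κ) + Real.log (1 / (4 * κ) * (2 / κ)) = - (3 * Real.log κ) := by
    rw [← Real.log_mul (by positivity) (by positivity)]
    rw [show 2 / κ * (1 / (4 * κ) * (2 / κ)) = (κ ^ 3)⁻¹ by field_simp; norm_num, Real.log_inv,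
      Real.log_pow]
    norm_num
  have l2 : 2 * Real.log (2 * E) = Real.log 64 - 2 * Real.log κ := by
    rw [hE, show 2 * (4 / κ) = 8 / κ by ring, Real.log_div (by norm_num) hκ0.ne',
      show (64:ℝ) = 8 ^ 2 by norm_num, Real.log_pow]
    push_cast; ring
  have l3 : Real.log 64 < Real.log 100 := Real.log_lt_log (by norm_num) (by norm_num)
  linarith

lemma growth (δ : ℝ) (hδ : 0 ≤ δ) : ∃ L : ℝ, 1 < L ∧ ∀ (n : ℕ) (C : Set (Euc n)), BOC C →
    IsDeltaHyp C δ → ∀ b h v : Euc n, (∀ x y : ℝ, x • h + y • v = 0 → x = 0 ∧ y = 0) →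
    (∀ x y, ptc b h v x y ∈ C → 0 < y) → ∀ l : ℝ,
    (∀ y, 0 < y → y < l → ptc b h v 0 y ∈ C) → ∀ x d σ : ℝ, 0 < σ → 2 * (L * σ) ≤ l →
    d ≤ 2 * σ → ptc b h v x d ∈ C → ptc b h v (32 * x) (L * σ) ∈ C := by
  obtain ⟨κ, hκ⟩ : ∃ κ, κ = Real.exp (-(4 * δ)) / 100 := ⟨_, rfl⟩
  have hκ0 : 0 < κ := by rw [hκ]; positivity
  have hκ1 : κ ≤ 1/100 := by
    rw [hκ]
    have : Real.exp (-(4 * δ)) ≤ 1 := Real.exp_le_one_iff.mpr (by linarith)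
    linarith
  have hM1 : 1 ≤ 8 / κ ^ 2 := by
    rw [le_div_iff₀ (by positivity)]; nlinarith
  obtain ⟨N, hN⟩ := pow_unbounded_of_one_lt 64 (by linarith : 1 < 1 + κ)
  refine ⟨2 * (8 / κ ^ 2) ^ N, by linarith [one_le_pow₀ hM1 (n := N)], ?_⟩
  intro n C hC hyp
  have main : ∀ b h v : Euc n, (∀ x y : ℝ, x • h + y • v = 0 → x = 0 ∧ y = 0) →
    (∀ x y, ptc b h v x y ∈ C → 0 < y) → ∀ l : ℝ,
    (∀ y, 0 < y → y < l → ptc b h v 0 y ∈ C) → ∀ x d σ : ℝ, 0 < x → 0 < σ →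
    2 * (2 * (8 / κ ^ 2) ^ N * σ) ≤ l →
    d ≤ 2 * σ → ptc b h v x d ∈ C → ptc b h v (32 * x) (2 * (8 / κ ^ 2) ^ N * σ) ∈ C := by
    intro b h v hind hpos l hv x d σ hx hσ hl hd hmem
    have it : ∀ k, k ≤ N → ∃ d', d' ≤ (8 / κ ^ 2) ^ k * (2 * σ) ∧
        ptc b h v ((1 + κ) ^ k * x) d' ∈ C := by
      intro k
      induction k with
      | zero => intro _; exact ⟨d, by simpa using hd, by simpa using hmem⟩
      | succ k ih =>
        intro hk
        obtain ⟨d', h1, h2⟩ := ih (by omega)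
        have := hyp_step hC hδ hyp hκ hind hpos hv (by positivity) h1 h2 ?_
        · obtain ⟨d'', h3, h4⟩ := this
          refine ⟨d'', h3.trans (by rw [pow_succ _ k]; exact le_of_eq (by ring)), ?_⟩
          rw [pow_succ, mul_comm (_ ^ k), mul_assoc]; exact h4
        · have : (8 / κ ^ 2) ^ (k+1) ≤ (8 / κ ^ 2) ^ N := pow_le_pow_right₀ hM1 hk
          have h5 : (8 / κ ^ 2) ^ (k+1) * σ ≤ (8 / κ ^ 2) ^ N * σ := by gcongr
          rw [pow_succ] at h5
          linarith
    obtain ⟨d', h1, h2⟩ := it N le_rfl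
    have hd' := hpos _ _ h2
    set S := (8 / κ ^ 2) ^ N * σ with hS
    have hS0 : 0 < S := by positivity
    have hl' : 4 * S ≤ l := by rw [hS]; linarith
    have h1' : d' ≤ 2 * S := by rw [hS]; linarith
    have m1 := ptc_combo hC h2 (hv (4 * S - d') (by linarith) (by linarith)) (s := 1/2)
      (by norm_num) (by norm_num)
    have m2 := hv (2 * S) (by linarith) (by linarith)
    have hp : 0 < (1 + κ) ^ N := by positivity
    have m3 := ptc_combo hC m2 m1 (s := 64 / (1 + κ) ^ N) (by positivity)
      (by rw [div_le_one hp]; exact hN.le)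
    convert m3 using 1
    congr 1
    · field_simp; ring
    · rw [hS]; ring
  intro b h v hind hpos l hv x d σ hσ hl hd hmem
  rcases lt_trichotomy x 0 with hx | hx | hx
  · have e : ∀ x y, ptc b (-h) v x y = ptc b h v (-x) y := fun x y => by unfold ptc; module
    have := main b (-h) v (fun x y hxy => ?_) (fun x y hxy => hpos (-x) y (by rwa [← e])) l
      (fun y h1 h2 => by rw [e, neg_zero]; exact hv y h1 h2) (-x) d σ (by linarith) hσ hl hd
      (by rw [e, neg_neg]; exact hmem)
    · rw [e] at this
      convert this using 2
      ring
    · have := hind (-x) y (by rw [← hxy]; module)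
      exact ⟨by linarith [this.1], this.2⟩
  · subst hx
    rw [mul_zero]
    have : 0 < 2 * (8 / κ ^ 2) ^ N * σ := by positivity
    exact hv _ this (by linarith)
  · exact main b h v hind hpos l hv x d σ hx hσ hl hd hmem


lemma hardy_core {a l A : ℝ} (hal : a < l) (ha : 0 < a) {W g : ℝ → ℝ} {K : ℝ≥0}
    (hA : 0 ≤ A)
    (hW : ContinuousOn W (Icc a l)) (hWp : ∀ x ∈ Icc a l, 0 < W x)
    (hG : ∀ x ∈ Icc a l, ∫ t in x..l, W t ≤ A * x * W x)
    (hg : LipschitzWith K g) (hga : g a = 0) :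
    IntervalIntegrable (fun x => (x * deriv g x) ^ 2 * W x) volume a l ∧
    ∫ x in a..l, g x ^ 2 * W x ≤ 4 * A ^ 2 * ∫ x in a..l, (x * deriv g x) ^ 2 * W x := by
  have huI : uIcc a l = Icc a l := uIcc_of_le hal.le
  have hWi : IntervalIntegrable W volume a l := by
    apply ContinuousOn.intervalIntegrable; rwa [huI]
  have gac : AbsolutelyContinuousOnInterval g a l :=
    (hg.lipschitzOnWith (s := uIcc a l)).absolutelyContinuousOnInterval
  set G : ℝ → ℝ := fun u => ∫ t in u..l, W t with hGdef
  have Gac : AbsolutelyContinuousOnInterval G a l := by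
    have := (hWi.absolutelyContinuousOnInterval_intervalIntegral (c := l) (by simp)).neg
    have e : G = -fun x => ∫ v in l..x, W v := by
     refine funext fun u => ?_
     show (∫ t in u..l, W t) = -∫ t in l..u, W t
     exact intervalIntegral.integral_symm _ _
    rw [e]; exact this
  have ggac := gac.fun_mul gac
  have ibp := ggac.integral_deriv_mul_eq_sub Gac
  have hGl : G l = 0 := by simp [hGdef]
  rw [hGl, hga] at ibp
  simp only [mul_zero, zero_mul, sub_self] at ibp
  have i1 : IntervalIntegrable (fun x => deriv (fun x => g x * g x) x * G x +
      g x * g x * deriv G x) volume a l :=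
    (ggac.intervalIntegrable_deriv.mul_continuousOn Gac.continuousOn).add
      (Gac.intervalIntegrable_deriv.continuousOn_mul ggac.continuousOn)
  have i2 : IntervalIntegrable (fun x => g x ^ 2 * W x) volume a l := by
    apply ContinuousOn.intervalIntegrable
    rw [huI]
    exact (hg.continuous.continuousOn.pow 2).mul hW
  have i3 : IntervalIntegrable (fun x => (x * deriv g x) ^ 2 * W x) volume a l := by
    have : IntervalIntegrable (fun x => (deriv g x) ^ 2) volume a l := by
      have hb : IntervalIntegrable (fun _ : ℝ => (K:ℝ) ^ 2) volume a l :=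
        intervalIntegrable_const
      refine hb.mono_fun ?_ ?_
      · exact ((measurable_deriv g).pow_const 2).aestronglyMeasurable
      · refine Eventually.of_forall fun x => ?_
        have := norm_deriv_le_of_lipschitz hg (x₀ := x)
        simp only [norm_pow]
        gcongr
        simpa using this
    have h2 := this.mul_continuousOn (g := fun x => x ^ 2 * W x)
      (by rw [huI]; exact (continuous_id.continuousOn.pow 2).mul hW)
    convert h2 using 2
    ring
  refine ⟨i3, ?_⟩
  have i4 : IntervalIntegrable (fun x => 2 * A ^ 2 * ((x * deriv g x) ^ 2 * W x)
      - 1 / 2 * (g x ^ 2 * W x)) volume a l := (i3.const_mul _).sub (i2.const_mul _)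
  have mono := intervalIntegral.integral_mono_ae_restrict hal.le i1 i4 ?_
  · rw [ibp, intervalIntegral.integral_sub (i3.const_mul _) (i2.const_mul _),
      intervalIntegral.integral_const_mul, intervalIntegral.integral_const_mul] at mono
    linarith
  · have hIoo : ∀ᵐ x ∂(volume.restrict (Icc a l)), x ∈ Ioo a l := by
      rw [← restrict_Ioo_eq_restrict_Icc]
      exact ae_restrict_mem measurableSet_Ioo
    filter_upwards [hIoo, ae_restrict_of_ae (hg.ae_differentiableAt_real)] with x hx hdx
    have hxI : x ∈ Icc a l := Ioo_subset_Icc_self hx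
    have hdG : deriv G x = - W x := by
      have hnear : Icc a l ∈ nhds x := Icc_mem_nhds hx.1 hx.2
      have : IntervalIntegrable W volume x l := by
        apply ContinuousOn.intervalIntegrable
        rw [uIcc_of_le hxI.2]
        exact hW.mono (Icc_subset_Icc_left hxI.1)
      refine (intervalIntegral.integral_hasDerivAt_left this ?_ (hW.continuousAt hnear)).deriv
      exact ContinuousOn.stronglyMeasurableAtFilter isOpen_Ioo
        (hW.mono Ioo_subset_Icc_self) x hx
    have hdg : deriv (fun x => g x * g x) x = 2 * g x * deriv g x := by
      rw [(hdx.hasDerivAt.fun_mul hdx.hasDerivAt).deriv]; ring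
    rw [hdG, hdg]
    have h1 := hG x hxI
    have h0 : 0 ≤ G x := by
      apply intervalIntegral.integral_nonneg hxI.2
      intro t ht
      exact (hWp t ⟨hxI.1.trans ht.1, ht.2⟩).le
    have hw := hWp x hxI
    have hx0 : 0 < x := ha.trans hx.1
    have k1 : 2 * g x * deriv g x * G x ≤ 2 * (|g x| * |deriv g x|) * (A * x * W x) := by
      have e : 2 * g x * deriv g x * G x ≤ 2 * (|g x| * |deriv g x|) * G x := by
        apply mul_le_mul_of_nonneg_right _ h0
        rw [← abs_mul, mul_assoc]
        linarith [le_abs_self (g x * deriv g x)]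
      exact e.trans (mul_le_mul_of_nonneg_left h1 (by positivity))
    have k2 : 0 ≤ 1 / 2 * (|g x| - 2 * A * x * |deriv g x|) ^ 2 * W x := by positivity
    have k3 : |g x| ^ 2 = g x ^ 2 := sq_abs _
    have k4 : |deriv g x| ^ 2 = deriv g x ^ 2 := sq_abs _
    have k5 : 1 / 2 * (|g x| - 2 * A * x * |deriv g x|) ^ 2 * W x
      = 1 / 2 * (g x ^ 2 * W x) - 2 * (|g x| * |deriv g x|) * (A * x * W x)
        + 2 * A ^ 2 * ((x * deriv g x) ^ 2 * W x) := by
      rw [mul_pow x, ← k3, ← k4]; ring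
    have k6 : g x * g x * -W x = - (g x ^ 2 * W x) := by ring
    rw [k6]
    linarith

lemma weight_bound {l L : ℝ} {W : ℝ → ℝ} (hL : 1 < L) (hW : ContinuousOn W (Ioc 0 l))
    (hWp : ∀ x ∈ Ioc 0 l, 0 < W x)
    (h1 : ∀ e t, 0 < e → e ≤ t → t ≤ l → W t ≤ 4 * W e)
    (h2 : ∀ s, 0 < s → L * s ≤ l → 2 * L * W (L * s) ≤ W s) :
    ∀ x ∈ Ioc 0 l, ∫ t in x..l, W t ≤ 8 * L * x * W x := by
  intro x hx
  have hx0 := hx.1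
  have hxl := hx.2
  have hint : ∀ a b, 0 < a → a ≤ b → b ≤ l → IntervalIntegrable W volume a b := by
    intro a b ha hab hb
    apply ContinuousOn.intervalIntegrable
    rw [uIcc_of_le hab]
    exact hW.mono fun t ht => ⟨ha.trans_le ht.1, ht.2.trans hb⟩
  have hb1 : ∀ b, x ≤ b → b ≤ l → ∫ t in x..b, W t ≤ 4 * W x * (b - x) := by
    intro b hxb hb
    have := intervalIntegral.integral_mono_on hxb (hint x b hx0 hxb hb)
      (intervalIntegrable_const (c := 4 * W x)) (fun t ht => h1 x t hx0 ht.1 (ht.2.trans hb))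
    rw [intervalIntegral.integral_const, smul_eq_mul] at this
    linarith
  have hWx := hWp x hx
  have hxL : x ≤ L * x := by nlinarith
  have hp : 0 < L * x * W x := by positivity
  have hp' : 0 < x * W x := by positivity
  by_cases hc : L * x ≤ l
  · have e1 : ∫ t in x..l, W t = (∫ t in x..(L * x), W t) + ∫ t in (L * x)..l, W t :=
      (intervalIntegral.integral_add_adjacent_intervals (hint _ _ hx0 hxL hc)
        (hint _ _ (by positivity) hc le_rfl)).symm
    have hL0 : 0 < L := by linarith
    have hxl' : x ≤ l / L := by rw [le_div_iff₀ hL0]; linarith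
    have hll : l / L ≤ l := by rw [div_le_iff₀ hL0]; nlinarith
    have e2 : ∫ t in (L * x)..l, W t = L * ∫ s in x..(l / L), W (L * s) := by
      rw [intervalIntegral.mul_integral_comp_mul_left]
      congr 1
      field_simp
    have e3 : ∫ s in x..(l / L), W (L * s) ≤ ∫ s in x..(l / L), 1 / (2 * L) * W s := by
      apply intervalIntegral.integral_mono_on hxl'
      · apply ContinuousOn.intervalIntegrable
        rw [uIcc_of_le hxl']
        refine hW.comp (by fun_prop) fun t ht => ⟨?_, ?_⟩
        · have := hx0.trans_le ht.1
          positivity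
        · have := ht.2
          rw [le_div_iff₀ hL0] at this
          linarith
      · exact (hint _ _ hx0 hxl' hll).const_mul _
      · intro t ht
        have ht2 := ht.2
        rw [le_div_iff₀ hL0] at ht2
        have := h2 t (hx0.trans_le ht.1) (by linarith)
        rw [one_div, ← div_eq_inv_mul, le_div_iff₀ (by positivity)]
        linarith
    rw [intervalIntegral.integral_const_mul] at e3
    have e4 : ∫ s in x..(l / L), W s ≤ ∫ s in x..l, W s := by
      rw [← intervalIntegral.integral_add_adjacent_intervals (hint _ _ hx0 hxl' hll)
        (hint _ _ (hx0.trans_le hxl') hll le_rfl)]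
      have := intervalIntegral.integral_nonneg (μ := volume) hll (f := W)
        (fun t ht => (hWp t ⟨(hx0.trans_le hxl').trans_le ht.1, ht.2⟩).le)
      linarith
    have e5 : L * ∫ s in x..(l / L), W (L * s) ≤ 1 / 2 * ∫ s in x..(l / L), W s := by
      calc _ ≤ L * (1 / (2 * L) * ∫ s in x..(l / L), W s) := by gcongr
        _ = _ := by field_simp
    have e6 := hb1 (L * x) hxL hc
    nlinarith
  · push Not at hc
    have := hb1 l hxl le_rfl
    nlinarith

lemma hardy_half {l L : ℝ} {W g D : ℝ → ℝ} {K : ℝ≥0} (hl : 0 < l)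
    (hL : 1 < L) (hW : ContinuousOn W (Ioc 0 l))
    (hWp : ∀ x ∈ Ioc 0 l, 0 < W x)
    (h1 : ∀ e t, 0 < e → e ≤ t → t ≤ l → W t ≤ 4 * W e)
    (h2 : ∀ s, 0 < s → L * s ≤ l → 2 * L * W (L * s) ≤ W s)
    (hg : LipschitzWith K g) (hg0 : ∃ a, 0 < a ∧ ∀ x ∈ Icc 0 a, g x = 0)
    (hD : ∀ᵐ x, x ∈ Ioc 0 l → |x * deriv g x| ≤ D x) :
    ∫⁻ x in Ioc 0 l, ENNReal.ofReal (g x ^ 2 * W x) ≤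
      ENNReal.ofReal (4 * (8 * L) ^ 2) * ∫⁻ x in Ioc 0 l, ENNReal.ofReal (D x ^ 2 * W x) := by
  obtain ⟨a0, ha0, hga0⟩ := hg0
  obtain ⟨a, ha, hal, haa⟩ : ∃ a, 0 < a ∧ a < l ∧ a ≤ a0 :=
    ⟨min a0 (l / 2), lt_min ha0 (by linarith), (min_le_right _ _).trans_lt (by linarith),
      min_le_left _ _⟩
  have hga : ∀ x ∈ Icc 0 a, g x = 0 := fun x hx => hga0 x ⟨hx.1, hx.2.trans haa⟩
  have hsub : Icc a l ⊆ Ioc 0 l := fun x hx => ⟨ha.trans_le hx.1, hx.2⟩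
  obtain ⟨i3, core⟩ := hardy_core hal ha (by linarith : 0 ≤ 8 * L) (hW.mono hsub)
    (fun x hx => hWp x (hsub hx))
    (fun x hx => weight_bound hL hW hWp h1 h2 x (hsub hx)) hg (hga a ⟨ha.le, le_rfl⟩)
  have i2 : IntervalIntegrable (fun x => g x ^ 2 * W x) volume a l := by
    apply ContinuousOn.intervalIntegrable
    rw [uIcc_of_le hal.le]
    exact (hg.continuous.continuousOn.pow 2).mul (hW.mono hsub)
  have hunion : Ioc 0 l = Ioc 0 a ∪ Ioc a l := (Ioc_union_Ioc_eq_Ioc ha.le hal.le).symm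
  have hsub2 : Ioc a l ⊆ Ioc 0 l := Ioc_subset_Ioc_left ha.le
  have z : ∫⁻ x in Ioc 0 a, ENNReal.ofReal (g x ^ 2 * W x) = 0 := by
    rw [setLIntegral_congr_fun measurableSet_Ioc (g := fun _ => 0)]
    · simp
    · intro x hx
      simp [hga x ⟨hx.1.le, hx.2⟩]
  calc ∫⁻ x in Ioc 0 l, ENNReal.ofReal (g x ^ 2 * W x)
      ≤ ∫⁻ x in Ioc a l, ENNReal.ofReal (g x ^ 2 * W x) := by
        rw [hunion]
        refine (lintegral_union_le _ _ _).trans ?_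
        rw [z, zero_add]
    _ = ENNReal.ofReal (∫ x in a..l, g x ^ 2 * W x) := by
        rw [intervalIntegral.integral_of_le hal.le,
          ofReal_integral_eq_lintegral_ofReal i2.1]
        refine ae_restrict_of_forall_mem measurableSet_Ioc fun x hx => ?_
        have := hWp x (hsub2 hx)
        simp only [Pi.zero_apply]; positivity
    _ ≤ ENNReal.ofReal (4 * (8 * L) ^ 2 * ∫ x in a..l, (x * deriv g x) ^ 2 * W x) :=
        ENNReal.ofReal_le_ofReal core
    _ = ENNReal.ofReal (4 * (8 * L) ^ 2) *
          ∫⁻ x in Ioc a l, ENNReal.ofReal ((x * deriv g x) ^ 2 * W x) := by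
        rw [ENNReal.ofReal_mul (by positivity), intervalIntegral.integral_of_le hal.le,
          ofReal_integral_eq_lintegral_ofReal i3.1]
        refine ae_restrict_of_forall_mem measurableSet_Ioc fun x hx => ?_
        have := hWp x (hsub2 hx)
        simp only [Pi.zero_apply]; positivity
    _ ≤ ENNReal.ofReal (4 * (8 * L) ^ 2) *
          ∫⁻ x in Ioc a l, ENNReal.ofReal (D x ^ 2 * W x) := by
        refine mul_le_mul' le_rfl ?_
        apply lintegral_mono_ae
        filter_upwards [ae_restrict_of_ae hD, ae_restrict_mem measurableSet_Ioc] with x hx hxm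
        apply ENNReal.ofReal_le_ofReal
        have := hWp x (hsub2 hxm)
        have h3 := hx (hsub2 hxm)
        have : (x * deriv g x) ^ 2 ≤ D x ^ 2 := by
          rw [← sq_abs]; gcongr
        gcongr
    _ ≤ _ := by
        refine mul_le_mul' le_rfl ?_
        exact lintegral_mono_set hsub2


/-- density -/
noncomputable def dens {n : ℕ} (C : Set (Euc n)) (p : Euc n) : ℝ :=
  omegaVol n / (volume (tangentBall C p 1)).toReal

namespace BOC
variable {n : ℕ} {C : Set (Euc n)}

lemma ball_sub (hC : BOC C) {p : Euc n} (hp : p ∈ C) :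
    ∃ r, 0 < r ∧ Metric.ball p r ⊆ C ∧ Metric.ball 0 r ⊆ tangentBall C p 1 := by
  obtain ⟨r, hr, h⟩ := Metric.isOpen_iff.1 hC.opn p hp
  refine ⟨r, hr, h, fun u hu => ?_⟩
  rw [mem_ball_zero_iff] at hu
  apply hC.fNorm_lt_one
  · apply h; simpa [dist_eq_norm] using hu
  · apply h; simpa [dist_eq_norm] using hu

lemma tb_sub (hC : BOC C) {p : Euc n} (hp : p ∈ C) :
    tangentBall C p 1 ⊆ Metric.closedBall 0 (3 * Metric.diam C) := by
  intro u hu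
  rw [mem_closedBall_zero_iff]
  exact hC.norm_le_diam hp (le_of_lt hu)

lemma vol_ne_top (hC : BOC C) {p : Euc n} (hp : p ∈ C) :
    volume (tangentBall C p 1) ≠ ⊤ :=
  ((measure_mono (hC.tb_sub hp)).trans_lt measure_closedBall_lt_top).ne

lemma vol_pos (hC : BOC C) {p : Euc n} (hp : p ∈ C) :
    0 < (volume (tangentBall C p 1)).toReal := by
  obtain ⟨r, hr, -, h⟩ := hC.ball_sub hp
  exact ENNReal.toReal_pos ((Metric.measure_ball_pos volume 0 hr).trans_le
    (measure_mono h)).ne' (hC.vol_ne_top hp)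

lemma omega_pos : 0 < omegaVol n :=
  ENNReal.toReal_pos (Metric.measure_ball_pos volume 0 one_pos).ne' measure_ball_lt_top.ne

lemma dens_pos (hC : BOC C) {p : Euc n} (hp : p ∈ C) : 0 < dens C p :=
  div_pos omega_pos (hC.vol_pos hp)

open scoped Pointwise in
lemma vol_le_of_smul (hC : BOC C) {p q : Euc n} (hq : q ∈ C) {c : ℝ} (hc : 0 < c)
    (h : ∀ u, c * fNorm C q u ≤ fNorm C p u) :
    c ^ n * (volume (tangentBall C p 1)).toReal ≤ (volume (tangentBall C q 1)).toReal := by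
  have hsub : c • tangentBall C p 1 ⊆ tangentBall C q 1 := by
    rintro _ ⟨u, hu, rfl⟩
    show fNorm C q (c • u) < 1
    rw [fNorm_smul hc]
    exact (h u).trans_lt hu
  have h1 := measure_mono (μ := volume) hsub
  rw [Measure.addHaar_smul] at h1
  have h2 := ENNReal.toReal_mono (hC.vol_ne_top hq) h1
  rw [ENNReal.toReal_mul, ENNReal.toReal_ofReal (abs_nonneg _), abs_of_pos (by positivity)] at h2
  simpa using h2

lemma dens_le_of_smul (hC : BOC C) {p q : Euc n} (hp : p ∈ C) (hq : q ∈ C) {c : ℝ} (hc : 0 < c)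
    (h : ∀ u, c * fNorm C q u ≤ fNorm C p u) :
    c ^ n * dens C q ≤ dens C p := by
  have h1 := hC.vol_le_of_smul hq hc h
  have hVp := hC.vol_pos hp
  have hVq := hC.vol_pos hq
  have ho := omega_pos (n := n)
  unfold dens
  rw [← mul_div_assoc, div_le_div_iff₀ hVq hVp]
  nlinarith

lemma near (hC : BOC C) {p : Euc n} (hp : p ∈ C) :
    ∃ r, 0 < r ∧ Metric.ball p r ⊆ C ∧ ∀ q, ‖q - p‖ < r → 
      (∀ u, (1 - ‖q - p‖ / r) * fNorm C q u ≤ fNorm C p u) ∧ 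
      (∀ u, (1 - ‖q - p‖ / r) * fNorm C p u ≤ fNorm C q u) := by
  obtain ⟨r0, hr0, h, -⟩ := hC.ball_sub hp
  refine ⟨r0 / 2, by positivity, (Metric.ball_subset_ball (by linarith)).trans h, fun q hq => ?_⟩
  set r := r0 / 2 with hr
  have hrp : 0 < r := by positivity
  have hqC : q ∈ C := h (by rw [Metric.mem_ball, dist_eq_norm]; linarith)
  set s := ‖q - p‖ / r with hs
  have hs0 : 0 ≤ s := by positivity
  have hs1 : s < 1 := by rw [hs, div_lt_one hrp]; exact hq
  rcases eq_or_ne q p with rfl | hne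
  · have : s = 0 := by simp [hs]
    rw [this]; simp
  have hsp : 0 < s := div_pos (norm_pos_iff.2 (sub_ne_zero.2 hne)) hrp
  have hns : ‖q - p‖ = s * r := by rw [hs]; field_simp
  constructor
  · refine hC.fNorm_compare hp (z := p + (1 / s) • (q - p)) ?_ hs0 hs1 ?_
    · apply h
      rw [Metric.mem_ball, dist_eq_norm, add_sub_cancel_left, norm_smul, hns,
        Real.norm_of_nonneg (by positivity)]
      have : 1 / s * (s * r) = r := by field_simp
      linarith
    · rw [smul_add, smul_smul, mul_one_div_cancel hsp.ne']
      module
  · refine hC.fNorm_compare hqC (z := p - ((1 - s) / s) • (q - p)) ?_ hs0 hs1 ?_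
    · apply h
      rw [Metric.mem_ball, dist_eq_norm, sub_sub_cancel_left, norm_neg, norm_smul, hns,
        Real.norm_of_nonneg (div_nonneg (by linarith) hs0)]
      have : (1 - s) / s * (s * r) = (1 - s) * r := by field_simp
      nlinarith
    · rw [smul_sub, smul_smul, mul_div_cancel₀ _ hsp.ne']
      module

lemma dens_cont (hC : BOC C) : ContinuousOn (dens C) C := by
  intro p hp
  obtain ⟨r, hr, hb, h⟩ := hC.near hp
  apply ContinuousAt.continuousWithinAt
  have t1 : Tendsto (fun q => (1 - ‖q - p‖ / r) ^ n) (nhds p) (nhds 1) := by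
    have : ContinuousAt (fun q => (1 - ‖q - p‖ / r) ^ n) p := by fun_prop
    have h2 := this.tendsto
    simpa using h2
  have hev : ∀ᶠ q in nhds p, q ∈ Metric.ball p r := Metric.ball_mem_nhds p hr
  have t2 : Tendsto (fun q => (1 - ‖q - p‖ / r) ^ n * dens C p) (nhds p) (nhds (dens C p)) := by
    simpa using t1.mul_const (dens C p)
  have t3 : Tendsto (fun q => dens C p / (1 - ‖q - p‖ / r) ^ n) (nhds p) (nhds (dens C p)) := by
    have := (tendsto_const_nhds (x := dens C p)).div t1 one_ne_zero
    rw [div_one] at this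
    exact this
  refine tendsto_of_tendsto_of_tendsto_of_le_of_le' t2 t3 ?_ ?_
  · filter_upwards [hev] with q hq
    have hq' : ‖q - p‖ < r := by rwa [Metric.mem_ball, dist_eq_norm] at hq
    have hc : 0 < 1 - ‖q - p‖ / r := by rw [sub_pos, div_lt_one hr]; exact hq'
    exact hC.dens_le_of_smul (hb hq) hp hc (h q hq').2
  · filter_upwards [hev] with q hq
    have hq' : ‖q - p‖ < r := by rwa [Metric.mem_ball, dist_eq_norm] at hq
    have hc : 0 < 1 - ‖q - p‖ / r := by rw [sub_pos, div_lt_one hr]; exact hq'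
    rw [le_div_iff₀ (by positivity), mul_comm]
    exact hC.dens_le_of_smul hp (hb hq) hc (h q hq').1

/-! dual norm -/
lemma dual_bdd (hC : BOC C) {p : Euc n} (hp : p ∈ C) (l : Euc n →L[ℝ] ℝ) :
    ‖l‖ * (3 * Metric.diam C) ∈ upperBounds ((fun u => l u) '' {u : Euc n | fNorm C p u = 1}) := by
  rintro _ ⟨u, hu, rfl⟩
  have h1 : l u ≤ ‖l‖ * ‖u‖ := (le_abs_self _).trans (l.le_opNorm u)
  have h2 := hC.norm_le_diam hp (le_of_eq hu)
  exact h1.trans (mul_le_mul_of_nonneg_left h2 (norm_nonneg _))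

lemma fNorm_zero' {p : Euc n} : fNorm C p 0 = 0 := by simp [fNorm]

lemma le_dual (hC : BOC C) {p : Euc n} (hp : p ∈ C) (l : Euc n →L[ℝ] ℝ) (u : Euc n) :
    l u ≤ dualNorm C p l * fNorm C p u := by
  rcases eq_or_ne u 0 with rfl | hu
  · simp [fNorm_zero']
  have hN := hC.fNorm_pos hp hu
  rw [← div_le_iff₀ hN]
  refine le_csSup ⟨_, hC.dual_bdd hp l⟩ ⟨(fNorm C p u)⁻¹ • u, ?_, ?_⟩
  · show fNorm C p _ = 1
    rw [fNorm_smul (by positivity)]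
    exact inv_mul_cancel₀ hN.ne'
  · simp only [map_smul, smul_eq_mul]
    field_simp

lemma fNorm_le_inv (hC : BOC C) {p v : Euc n} (hp : p ∈ C) {e : ℝ} (he : 0 < e)
    (h : ∀ t, |t| < e → p + t • v ∈ C) : e * fNorm C p v ≤ 1 := by
  by_contra hcon
  push Not at hcon
  have hN : 0 < fNorm C p v := by
    by_contra h0
    push Not at h0
    nlinarith
  set t := (fNorm C p v)⁻¹ with ht
  have ht0 : 0 < t := by positivity
  have hte : t < e := by
    rw [ht, inv_lt_iff_one_lt_mul₀ hN]; linarith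
  have h1 := hC.fNorm_lt_one (p := p) (u := t • v) (h t (by rwa [abs_of_pos ht0]))
    (by have := h (-t) (by rwa [abs_neg, abs_of_pos ht0])
        rwa [neg_smul, ← sub_eq_add_neg] at this)
  rw [fNorm_smul ht0, ht, inv_mul_cancel₀ hN.ne'] at h1
  exact lt_irrefl _ h1

variable [NeZero n]

lemma exists_ne : ∃ u : Euc n, u ≠ 0 := by
  have : Nontrivial (Euc n) := inferInstance
  exact _root_.exists_ne 0

lemma dual_nonneg (hC : BOC C) {p : Euc n} (hp : p ∈ C) (l : Euc n →L[ℝ] ℝ) :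
    0 ≤ dualNorm C p l := by
  obtain ⟨u, hu⟩ := exists_ne (n := n)
  have h1 := hC.le_dual hp l u
  have h2 := hC.le_dual hp l (-u)
  have h3 := hC.fNorm_pos hp hu
  have h4 := hC.fNorm_pos hp (neg_ne_zero.2 hu)
  rw [map_neg] at h2
  by_contra h
  push Not at h
  nlinarith

lemma dual_le (hC : BOC C) {p : Euc n} (hp : p ∈ C) (l : Euc n →L[ℝ] ℝ) {M : ℝ}
    (h : ∀ u, fNorm C p u = 1 → l u ≤ M) : dualNorm C p l ≤ M := by
  apply csSup_le
  · obtain ⟨u, hu⟩ := exists_ne (n := n)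
    have hN := hC.fNorm_pos hp hu
    refine ⟨_, (fNorm C p u)⁻¹ • u, ?_, rfl⟩
    show fNorm C p _ = 1
    rw [fNorm_smul (by positivity)]
    exact inv_mul_cancel₀ hN.ne'
  · rintro _ ⟨u, hu, rfl⟩
    exact h u hu

lemma dual_le_norm (hC : BOC C) {p : Euc n} (hp : p ∈ C) (l : Euc n →L[ℝ] ℝ) :
    dualNorm C p l ≤ ‖l‖ * (3 * Metric.diam C) :=
  hC.dual_le hp l fun u hu => hC.dual_bdd hp l ⟨u, hu, rfl⟩

lemma dual_zero (hC : BOC C) {p : Euc n} (hp : p ∈ C) : dualNorm C p 0 = 0 := by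
  refine le_antisymm ?_ (hC.dual_nonneg hp 0)
  simpa using hC.dual_le_norm hp 0

lemma dual_lip (hC : BOC C) {p : Euc n} (hp : p ∈ C) (l l' : Euc n →L[ℝ] ℝ) :
    dualNorm C p l ≤ dualNorm C p l' + ‖l - l'‖ * (3 * Metric.diam C) := by
  refine hC.dual_le hp l fun u hu => ?_
  have h1 := hC.le_dual hp l' u
  have h2 := hC.le_dual hp (l - l') u
  have h3 := hC.dual_le_norm hp (l - l')
  rw [hu, mul_one] at h1 h2
  have : (l - l') u = l u - l' u := rfl
  linarith

lemma dual_cmp (hC : BOC C) {p q : Euc n} (hp : p ∈ C) (hq : q ∈ C) (l : Euc n →L[ℝ] ℝ) {c : ℝ}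
    (hc : 0 < c) (h : ∀ u, c * fNorm C q u ≤ fNorm C p u) :
    c * dualNorm C p l ≤ dualNorm C q l := by
  rw [← le_div_iff₀' hc]
  refine hC.dual_le hp l fun u hu => ?_
  have h1 := hC.le_dual hq l u
  have h2 := h u
  rw [hu] at h2
  have h3 := hC.dual_nonneg hq l
  rw [le_div_iff₀ hc]
  nlinarith [mul_le_mul_of_nonneg_left h2 h3]

lemma dual_cont (hC : BOC C) : ContinuousOn (fun x : Euc n × (Euc n →L[ℝ] ℝ) => dualNorm C x.1 x.2)
    (C ×ˢ univ) := by
  rintro ⟨p, l⟩ ⟨hp, -⟩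
  simp only at hp
  obtain ⟨r, hr, hb, h⟩ := hC.near hp
  apply ContinuousAt.continuousWithinAt
  have hev : ∀ᶠ x : Euc n × (Euc n →L[ℝ] ℝ) in nhds (p, l), x.1 ∈ Metric.ball p r :=
    continuous_fst.continuousAt.eventually_mem (Metric.ball_mem_nhds p hr)
  have t1 : ContinuousAt (fun x : Euc n × (Euc n →L[ℝ] ℝ) => (1 - ‖x.1 - p‖ / r)) (p, l) := by
    fun_prop
  have t2 : Tendsto (fun x : Euc n × (Euc n →L[ℝ] ℝ) => (1 - ‖x.1 - p‖ / r) * dualNorm C p l 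
      - ‖l - x.2‖ * (3 * Metric.diam C)) (nhds (p, l)) (nhds (dualNorm C p l)) := by
    have : ContinuousAt (fun x : Euc n × (Euc n →L[ℝ] ℝ) => (1 - ‖x.1 - p‖ / r) * dualNorm C p l 
      - ‖l - x.2‖ * (3 * Metric.diam C)) (p, l) := by fun_prop
    simpa using this.tendsto
  have t3 : Tendsto (fun x : Euc n × (Euc n →L[ℝ] ℝ) => dualNorm C p l / (1 - ‖x.1 - p‖ / r)  
      + ‖x.2 - l‖ * (3 * Metric.diam C)) (nhds (p, l)) (nhds (dualNorm C p l)) := by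
    have : ContinuousAt (fun x : Euc n × (Euc n →L[ℝ] ℝ) => dualNorm C p l / (1 - ‖x.1 - p‖ / r)
      + ‖x.2 - l‖ * (3 * Metric.diam C)) (p, l) := by
      refine ContinuousAt.add (ContinuousAt.div continuousAt_const t1 (by simp)) (by fun_prop)
    simpa using this.tendsto
  refine tendsto_of_tendsto_of_tendsto_of_le_of_le' t2 t3 ?_ ?_
  · filter_upwards [hev] with x hq
    have hq' : ‖x.1 - p‖ < r := by rwa [Metric.mem_ball, dist_eq_norm] at hq
    have hc : 0 < 1 - ‖x.1 - p‖ / r := by rw [sub_pos, div_lt_one hr]; exact hq'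
    have h1 := hC.dual_cmp hp (hb hq) l hc (h _ hq').1
    have h2 := hC.dual_lip (hb hq) l x.2
    linarith
  · filter_upwards [hev] with x hq
    have hq' : ‖x.1 - p‖ < r := by rwa [Metric.mem_ball, dist_eq_norm] at hq
    have hc : 0 < 1 - ‖x.1 - p‖ / r := by rw [sub_pos, div_lt_one hr]; exact hq'
    have h1 := hC.dual_cmp (hb hq) hp l hc (h _ hq').2
    have h2 := hC.dual_lip (hb hq) x.2 l
    rw [← le_div_iff₀' hc] at h1
    linarith

lemma abs_le_dual (hC : BOC C) {p v : Euc n} (hp : p ∈ C) (l : Euc n →L[ℝ] ℝ) {e : ℝ} (he : 0 < e)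
    (h : ∀ t, |t| < e → p + t • v ∈ C) : |e * l v| ≤ dualNorm C p l := by
  have hd := hC.dual_nonneg hp l
  have a1 := hC.le_dual hp l v
  have a2 := hC.le_dual hp l (-v)
  have b1 := hC.fNorm_le_inv hp he h
  have b2 := hC.fNorm_le_inv (v := -v) hp he (fun t ht => by
    have := h (-t) (by rwa [abs_neg]); rwa [neg_smul, ← smul_neg] at this)
  rw [map_neg] at a2
  rw [abs_le]
  constructor <;> nlinarith

end BOC


/-- growth property -/
def Grow (L : ℝ) (C : Set (Euc 2)) : Prop :=
  ∀ b h v : Euc 2, (∀ x y : ℝ, x • h + y • v = 0 → x = 0 ∧ y = 0) →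
    (∀ x y, ptc b h v x y ∈ C → 0 < y) → ∀ l : ℝ,
    (∀ y, 0 < y → y < l → ptc b h v 0 y ∈ C) → ∀ x d σ : ℝ, 0 < σ → 2 * (L * σ) ≤ l →
    d ≤ 2 * σ → ptc b h v x d ∈ C → ptc b h v (32 * x) (L * σ) ∈ C

namespace BOC
variable {C : Set (Euc 2)}

lemma dens_mono4 (hC : BOC C) {b v : Euc 2} {l : ℝ}
    (hv : ∀ y, 0 < y → y < l → b + y • v ∈ C) {e t : ℝ} (he : 0 < e) (het : e ≤ t)
    (ht : 2 * t ≤ l) : dens C (b + t • v) ≤ 4 * dens C (b + e • v) := by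
  rcases het.eq_or_lt with rfl | hlt
  · have := hC.dens_pos (hv e he (by linarith)); linarith
  have hp := hv e he (by linarith)
  have hq := hv t (by linarith) (by linarith)
  have h := hC.dens_le_of_smul hp hq (c := 1 - 1/2) (by norm_num)
    (hC.fNorm_compare hp (hv (2 * t - e) (by linarith) (by linarith)) (by norm_num) (by norm_num)
      (by module))
  norm_num at h
  linarith

lemma support (hC : BOC C) {b v : Euc 2} (hb : b ∉ C) {s0 : ℝ} (hs0 : s0 ^ 2 = 1)
    (hv0 : v = !₂[0, s0]) {l : ℝ} (hl : 0 < l)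
    (hv : ∀ y, 0 < y → y < l → b + y • v ∈ C) :
    ∃ s : ℝ, ∀ x y, ptc b !₂[1, s] v x y ∈ C → 0 < y := by
  obtain ⟨φ, hφ⟩ := geometric_hahn_banach_open_point hC.cvx hC.opn hb
  have h1 := hφ _ (hv (l/2) (by linarith) (by linarith))
  rw [map_add, map_smul, smul_eq_mul] at h1
  have h2 : φ v < 0 := by
    by_contra hcon; push Not at hcon; nlinarith
  set e1 : Euc 2 := !₂[1, 0] with he1
  refine ⟨- φ e1 / φ v * s0, fun x y hxy => ?_⟩
  have hh : (!₂[1, - φ e1 / φ v * s0] : Euc 2) = e1 + (- φ e1 / φ v) • v := by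
    rw [hv0, he1]
    ext i; fin_cases i <;> simp
  have h3 := hφ _ hxy
  rw [hh, ptc, map_add, map_add, map_smul, map_smul, map_add, map_smul] at h3
  simp only [smul_eq_mul] at h3
  have : φ e1 + -φ e1 / φ v * φ v = 0 := by field_simp [h2.ne]; ring
  rw [this] at h3
  by_contra hcon
  push Not at hcon
  nlinarith

lemma dens_decay (hC : BOC C) {L : ℝ} (hL : 1 < L) (hG : Grow L C) {b v : Euc 2} (hb : b ∉ C)
    {s0 : ℝ} (hs0 : s0 ^ 2 = 1) (hv0 : v = !₂[0, s0]) {l : ℝ} (hl : 0 < l)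
    (hv : ∀ y, 0 < y → y < l → b + y • v ∈ C) {σ : ℝ} (hσ : 0 < σ) (hLσ : 2 * (L * σ) ≤ l) :
    2 * L * dens C (b + (L * σ) • v) ≤ dens C (b + σ • v) := by
  obtain ⟨s, hs⟩ := hC.support hb hs0 hv0 hl hv
  set h : Euc 2 := !₂[1, s] with hh
  have hind : ∀ x y : ℝ, x • h + y • v = 0 → x = 0 ∧ y = 0 := by
    intro x y hxy
    have e0 := congrArg (fun u : Euc 2 => u 0) hxy
    have e1 := congrArg (fun u : Euc 2 => u 1) hxy
    simp [hh, hv0] at e0 e1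
    refine ⟨e0, ?_⟩
    rw [e0] at e1
    rcases (by simpa using e1 : y = 0 ∨ s0 = 0) with h | h
    · exact h
    · rw [h] at hs0; norm_num at hs0
  have hv' : ∀ y, 0 < y → y < l → ptc b h v 0 y ∈ C := by
    intro y h1 h2
    have := hv y h1 h2
    simpa [ptc] using this
  have key := hG b h v hind hs l hv'
  have hσL : σ < L * σ := by nlinarith
  have hp : b + σ • v ∈ C := hv σ hσ (by linarith)
  have hq : b + (L * σ) • v ∈ C := hv _ (by linarith) (by linarith)
  set M : Matrix (Fin 2) (Fin 2) ℝ := !![8, 0; 8 * s - L / 4 * s, L / 4] with hM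
  set T : Euc 2 →ₗ[ℝ] Euc 2 := Matrix.toLpLin 2 2 M with hT
  have hdet : LinearMap.det T = 2 * L := by
    rw [hT, Matrix.toLpLin_eq_toLin, LinearMap.det_toLin, hM, Matrix.det_fin_two_of]
    ring
  have hTu : ∀ x y : ℝ, T (x • h + y • v) = (8 * x) • h + (L / 4 * y) • v := by
    intro x y
    rw [hT, Matrix.toLpLin_apply]
    ext i; fin_cases i
    · simp [hM, hh, hv0, Matrix.mulVec, dotProduct, Fin.sum_univ_two]
    · simp [hM, hh, hv0, Matrix.mulVec, dotProduct, Fin.sum_univ_two]; ring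
  have hcoord : ∀ u : Euc 2, ∃ x y : ℝ, u = x • h + y • v := by
    intro u
    refine ⟨u 0, s0 * (u 1 - s * u 0), ?_⟩
    ext i; fin_cases i
    · simp [hh, hv0]
    · simp [hh, hv0]
      linear_combination (-(u 1 - s * u 0)) * hs0
  have hsub : T '' tangentBall C (b + σ • v) 1 ⊆ tangentBall C (b + (L * σ) • v) 1 := by
    rintro _ ⟨u, hu, rfl⟩
    obtain ⟨x, y, rfl⟩ := hcoord u
    obtain ⟨m1, m2⟩ := hC.half_mem' hp hu
    have m1' : ptc b h v (x / 2) (σ + y / 2) ∈ C := by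
      convert m1 using 1; unfold ptc; module
    have m2' : ptc b h v (-(x / 2)) (σ - y / 2) ∈ C := by
      convert m2 using 1; unfold ptc; module
    have y1 := hs _ _ m1'
    have y2 := hs _ _ m2'
    have g1 := key _ _ σ hσ hLσ (by linarith) m1'
    have g2 := key _ _ σ hσ hLσ (by linarith) m2'
    have n1 : ptc b h v 0 (L * σ + L * y / 2) ∈ C := hv' _ (by nlinarith) (by nlinarith)
    have n2 : ptc b h v 0 (L * σ - L * y / 2) ∈ C := hv' _ (by nlinarith) (by nlinarith)
    rw [hTu]
    apply hC.fNorm_lt_one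
    · have := ptc_combo hC g1 n1 (s := 1/2) (by norm_num) (by norm_num)
      convert this using 1; unfold ptc; module
    · have := ptc_combo hC g2 n2 (s := 1/2) (by norm_num) (by norm_num)
      convert this using 1; unfold ptc; module
  have h1 := measure_mono (μ := volume) hsub
  rw [Measure.addHaar_image_linearMap, hdet] at h1
  have h2 := ENNReal.toReal_mono (hC.vol_ne_top hq) h1
  rw [ENNReal.toReal_mul, ENNReal.toReal_ofReal (abs_nonneg _), abs_of_pos (by linarith)] at h2
  have hVp := hC.vol_pos hp
  have hVq := hC.vol_pos hq
  have ho := omega_pos (n := 2)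
  unfold dens
  rw [← mul_div_assoc, div_le_div_iff₀ hVq hVp]
  nlinarith

lemma half_chord (hC : BOC C) {L : ℝ} (hL : 1 < L) (hG : Grow L C) {b v : Euc 2} (hb : b ∉ C)
    {s0 : ℝ} (hs0 : s0 ^ 2 = 1) (hv0 : v = !₂[0, s0]) {l : ℝ} (hl : 0 < l)
    (hv : ∀ y, 0 < y → y < 2 * l → b + y • v ∈ C) {f : Euc 2 → ℝ} {K : ℝ≥0}
    (hf : LipschitzWith K f) (hfs : tsupport f ⊆ C)
    (hd : ∀ᵐ x : ℝ, DifferentiableAt ℝ f (b + x • v)) :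
    ∫⁻ x in Ioc 0 l, ENNReal.ofReal (f (b + x • v) ^ 2 * dens C (b + x • v)) ≤
      ENNReal.ofReal (4 * (8 * L) ^ 2) * ∫⁻ x in Ioc 0 l,
        ENNReal.ofReal (dualNorm C (b + x • v) (fderiv ℝ f (b + x • v)) ^ 2
          * dens C (b + x • v)) := by
  have hmem : ∀ x ∈ Ioc 0 l, b + x • v ∈ C := fun x hx => hv x hx.1 (by linarith [hx.1, hx.2])
  have hcont : Continuous (fun x : ℝ => b + x • v) := by fun_prop
  have hlip : LipschitzWith ‖v‖₊ (fun x : ℝ => b + x • v) := by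
    refine LipschitzWith.of_dist_le_mul fun x y => ?_
    rw [dist_add_left, dist_eq_norm, ← sub_smul, norm_smul, mul_comm, dist_eq_norm]; rfl
  refine hardy_half (g := fun x => f (b + x • v)) (W := fun x => dens C (b + x • v))
    (D := fun x => dualNorm C (b + x • v) (fderiv ℝ f (b + x • v)))
    (K := K * ‖v‖₊) hl hL ?_ ?_ ?_ ?_ ?_ ?_ ?_
  · exact hC.dens_cont.comp hcont.continuousOn hmem
  · exact fun x hx => hC.dens_pos (hmem x hx)
  · exact fun e t he het ht => hC.dens_mono4 hv he het (by linarith)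
  · exact fun s hs hLs => hC.dens_decay hL hG hb hs0 hv0 (by linarith) hv hs (by linarith)
  · exact hf.comp hlip
  · have hb' : b ∈ (tsupport f)ᶜ := fun h => hb (hfs h)
    have ho : IsOpen ((fun x : ℝ => b + x • v) ⁻¹' (tsupport f)ᶜ) :=
      (isClosed_tsupport f).isOpen_compl.preimage hcont
    obtain ⟨a, ha, hh⟩ := Metric.isOpen_iff.1 ho 0 (by simpa using hb')
    refine ⟨a / 2, by linarith, fun x hx => ?_⟩
    have : x ∈ Metric.ball (0:ℝ) a := by
      rw [Metric.mem_ball, dist_zero_right, Real.norm_of_nonneg hx.1]; linarith [hx.2]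
    exact image_eq_zero_of_notMem_tsupport (hh this)
  · filter_upwards [hd] with x hx hxm
    have hder : HasDerivAt (fun x : ℝ => f (b + x • v)) (fderiv ℝ f (b + x • v) v) x := by
      have h1 : HasDerivAt (fun x : ℝ => b + x • v) v x := by
        simpa using ((hasDerivAt_id x).smul_const v).const_add b
      exact hx.hasFDerivAt.comp_hasDerivAt x h1
    rw [hder.deriv]
    refine hC.abs_le_dual (hmem x hxm) _ hxm.1 fun t ht => ?_
    rw [abs_lt] at ht
    have := hv (x + t) (by linarith) (by linarith [hxm.2])
    convert this using 1; module

end BOC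


namespace BOC
variable {C : Set (Euc 2)}

lemma line_ineq (hC : BOC C) {L : ℝ} (hL : 1 < L) (hG : Grow L C) {f : Euc 2 → ℝ} {K : ℝ≥0}
    (hf : LipschitzWith K f) (hfs : tsupport f ⊆ C) (x : ℝ)
    (hd : ∀ᵐ y : ℝ, DifferentiableAt ℝ f !₂[x, y]) :
    ∫⁻ y in {y : ℝ | !₂[x, y] ∈ C}, ENNReal.ofReal (f !₂[x, y] ^ 2 * dens C !₂[x, y]) ≤
      ENNReal.ofReal (4 * (8 * L) ^ 2) * ∫⁻ y in {y : ℝ | !₂[x, y] ∈ C},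
        ENNReal.ofReal (dualNorm C !₂[x, y] (fderiv ℝ f !₂[x, y]) ^ 2
          * dens C !₂[x, y]) := by
  set c := ENNReal.ofReal (4 * (8 * L) ^ 2)
  set F1 : ℝ → ℝ≥0∞ := fun y => ENNReal.ofReal (f !₂[x, y] ^ 2 * dens C !₂[x, y])
  set F2 : ℝ → ℝ≥0∞ := fun y => ENNReal.ofReal (dualNorm C !₂[x, y] (fderiv ℝ f !₂[x, y]) ^ 2
          * dens C !₂[x, y])
  have hvne : (!₂[0, 1] : Euc 2) ≠ 0 := by
    intro h
    have := congrArg (fun u : Euc 2 => u 1) h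
    simp at this
  have hpt : ∀ a y : ℝ, (!₂[x, a] : Euc 2) + y • !₂[0, 1] = !₂[x, a + y] := by
    intro a y; ext i; fin_cases i <;> simp
  have hpt2 : ∀ a y : ℝ, (!₂[x, a] : Euc 2) + y • !₂[0, -1] = !₂[x, a - y] := by
    intro a y; ext i; fin_cases i <;> simp [sub_eq_add_neg]
  rcases Set.eq_empty_or_nonempty {y : ℝ | !₂[x, y] ∈ C} with he | ⟨y0, hy0⟩
  · rw [he]; simp
  obtain ⟨A, hA⟩ : ∃ A, A = sInf (lineParams C !₂[x, 0] !₂[0, 1]) := ⟨_, rfl⟩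
  obtain ⟨B, hB⟩ : ∃ B, B = sSup (lineParams C !₂[x, 0] !₂[0, 1]) := ⟨_, rfl⟩
  have hS : {y : ℝ | !₂[x, y] ∈ C} = Ioo A B := by
    ext y
    have e := hpt 0 y
    rw [zero_add] at e
    constructor
    · intro hy
      rw [Set.mem_ofPred_eq, ← e] at hy
      exact ⟨hA ▸ hC.sInf_lt hvne hy, hB ▸ hC.lt_sSup hvne hy⟩
    · rintro ⟨h1, h2⟩
      rw [Set.mem_ofPred_eq, ← e]
      exact hC.mem_of_lt hvne (hA ▸ h1) (hB ▸ h2)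
  have hmem : ∀ y, !₂[x, y] ∈ C ↔ A < y ∧ y < B := fun y => Set.ext_iff.1 hS y
  have hAB : A < B := ((hmem y0).1 hy0).1.trans ((hmem y0).1 hy0).2
  rw [hS]
  obtain ⟨l, hl⟩ : ∃ l, l = (B - A) / 2 := ⟨_, rfl⟩
  have hl0 : 0 < l := by rw [hl]; linarith
  set m := A + l with hm
  have hm2 : m = B - l := by rw [hm, hl]; ring
  have mp1 := measurePreserving_add_left (volume : Measure ℝ) A
  have mp2 := Measure.measurePreserving_sub_left (volume : Measure ℝ) B
  have em1 : MeasurableEmbedding (fun t : ℝ => A + t) := measurableEmbedding_addLeft A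
  have em2 : MeasurableEmbedding (fun t : ℝ => B - t) := measurableEmbedding_subLeft B
  have pre1 : (fun t : ℝ => A + t) ⁻¹' Ioc A m = Ioc 0 l := by
    ext t; simp [hm]
  have pre2 : (fun t : ℝ => B - t) ⁻¹' Ico m B = Ioc 0 l := by
    ext t; simp [hm2]
  have c1 : ∀ F : ℝ → ℝ≥0∞, ∫⁻ y in Ioc A m, F y = ∫⁻ t in Ioc 0 l, F (A + t) := by
    intro F; rw [← mp1.setLIntegral_comp_preimage_emb em1, pre1]
  have c2 : ∀ F : ℝ → ℝ≥0∞, ∫⁻ y in Ico m B, F y = ∫⁻ t in Ioc 0 l, F (B - t) := by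
    intro F; rw [← mp2.setLIntegral_comp_preimage_emb em2, pre2]
  have h1 : ∫⁻ y in Ioc A m, F1 y ≤ c * ∫⁻ y in Ioc A m, F2 y := by
    rw [c1, c1]
    have := hC.half_chord hL hG (b := !₂[x, A]) (v := !₂[0, 1]) (fun h => lt_irrefl _ ((hmem _).1 h).1)
      (s0 := 1) (by norm_num) rfl hl0 (fun y hy1 hy2 => by
        rw [hpt, hmem]; constructor <;> linarith) hf hfs (by
        have := mp1.quasiMeasurePreserving.ae hd
        simpa only [hpt] using this)
    simpa only [hpt] using this
  have h2 : ∫⁻ y in Ico m B, F1 y ≤ c * ∫⁻ y in Ico m B, F2 y := by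
    rw [c2, c2]
    have := hC.half_chord hL hG (b := !₂[x, B]) (v := !₂[0, -1]) (fun h => lt_irrefl _ ((hmem _).1 h).2)
      (s0 := -1) (by norm_num) rfl hl0 (fun y hy1 hy2 => by
        rw [hpt2, hmem]; constructor <;> linarith) hf hfs (by
        have := mp2.quasiMeasurePreserving.ae hd
        simpa only [hpt2] using this)
    simpa only [hpt2] using this
  have hu : Ioo A B = Ioc A m ∪ Ioo m B := 
    (Ioc_union_Ioo_eq_Ioo (by linarith) (by linarith)).symm
  have hdj : Disjoint (Ioc A m) (Ioo m B) := by
    rw [Set.disjoint_left]; intro y hy hy'; exact absurd hy.2 (not_le.2 hy'.1)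
  have e2 : ∀ F : ℝ → ℝ≥0∞, ∫⁻ y in Ioo m B, F y = ∫⁻ y in Ico m B, F y :=
    fun F => setLIntegral_congr Ioo_ae_eq_Ico
  rw [hu, lintegral_union measurableSet_Ioo hdj, lintegral_union measurableSet_Ioo hdj, e2, e2, 
    mul_add]
  exact add_le_add h1 h2

lemma dens_aem (hC : BOC C) : AEMeasurable (dens C) (volume.restrict C) :=
  hC.dens_cont.aemeasurable hC.opn.measurableSet

lemma dual_aem (hC : BOC C) (f : Euc 2 → ℝ) :
    AEMeasurable (fun p => dualNorm C p (fderiv ℝ f p)) (volume.restrict C) := by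
  classical
  have h1 := hC.dual_cont
  have hm : MeasurableSet (C ×ˢ (univ : Set (Euc 2 →L[ℝ] ℝ))) :=
    hC.opn.measurableSet.prod MeasurableSet.univ
  have h2 : Measurable ((C ×ˢ (univ : Set (Euc 2 →L[ℝ] ℝ))).piecewise
      (fun x : Euc 2 × (Euc 2 →L[ℝ] ℝ) => dualNorm C x.1 x.2) (fun _ => 0)) :=
    h1.measurable_piecewise continuousOn_const hm
  have h3 := h2.comp (measurable_id.prodMk (measurable_fderiv ℝ f))
  refine ⟨_, h3, ?_⟩
  filter_upwards [ae_restrict_mem hC.opn.measurableSet] with p hp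
  simp [Set.piecewise, hp]

lemma plane_ineq (hC : BOC C) {L : ℝ} (hL : 1 < L) (hG : Grow L C) {f : Euc 2 → ℝ} {K : ℝ≥0}
    (hf : LipschitzWith K f) (hfs : tsupport f ⊆ C) :
    ∫⁻ p in C, ENNReal.ofReal (f p ^ 2 * dens C p) ≤
      ENNReal.ofReal (4 * (8 * L) ^ 2) * ∫⁻ p in C,
        ENNReal.ofReal (dualNorm C p (fderiv ℝ f p) ^ 2 * dens C p) := by
  set Φ : ℝ × ℝ ≃ᵐ Euc 2 :=
    (MeasurableEquiv.finTwoArrow (α := ℝ)).symm.trans (MeasurableEquiv.toLp 2 (Fin 2 → ℝ)) with hΦ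
  have hmp : MeasurePreserving Φ (volume : Measure (ℝ × ℝ)) (volume : Measure (Euc 2)) :=
    (PiLp.volume_preserving_toLp (Fin 2)).comp ((volume_preserving_finTwoArrow ℝ).symm _)
  have hΦa : ∀ x y : ℝ, Φ (x, y) = !₂[x, y] := fun x y => rfl
  have hCm := hC.opn.measurableSet
  have tr : ∀ F : Euc 2 → ℝ≥0∞, ∫⁻ p in C, F p = ∫⁻ z : ℝ × ℝ, (C.indicator F) (Φ z) := by
    intro F
    rw [hmp.lintegral_comp_emb Φ.measurableEmbedding, lintegral_indicator hCm]
  have inner : ∀ (F : Euc 2 → ℝ≥0∞) (x : ℝ), ∫⁻ y : ℝ, (C.indicator F) (Φ (x, y)) =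
      ∫⁻ y in {y : ℝ | !₂[x, y] ∈ C}, F !₂[x, y] := by
    intro F x
    have hms : MeasurableSet {y : ℝ | !₂[x, y] ∈ C} := by
      have : Measurable (fun y : ℝ => Φ (x, y)) := Φ.measurable.comp measurable_prodMk_left
      exact this hCm
    rw [← lintegral_indicator hms]
    rfl
  have hdiff : ∀ᵐ z : ℝ × ℝ, DifferentiableAt ℝ f (Φ z) :=
    hmp.quasiMeasurePreserving.ae (hf.ae_differentiableAt (μ := volume))
  have hdiff2 := Measure.ae_ae_of_ae_prod hdiff
  rw [tr, tr]
  refine (lintegral_prod_le _).trans ?_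
  have hm : AEMeasurable (fun p => ENNReal.ofReal (dualNorm C p (fderiv ℝ f p) ^ 2 * dens C p))
      (volume.restrict C) := (((hC.dual_aem f).pow_const 2).mul hC.dens_aem).ennreal_ofReal
  have hm2 := (aemeasurable_indicator_iff hCm).2 hm
  have hm3 := hm2.comp_quasiMeasurePreserving hmp.quasiMeasurePreserving
  rw [show (volume : Measure (ℝ × ℝ)) = (volume : Measure ℝ).prod volume from rfl] at hm3 ⊢
  simp only [Function.comp_def] at hm3
  rw [lintegral_prod _ hm3, ← lintegral_const_mul' _ _ ENNReal.ofReal_ne_top]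
  apply lintegral_mono_ae
  filter_upwards [hdiff2] with x hx
  have := hC.line_ineq hL hG hf hfs x hx
  rw [inner]
  rw [inner]
  exact this

end BOC


namespace BOC
variable {C : Set (Euc 2)}

lemma hM_eq : (hMeasure C).restrict C =
    (volume.restrict C).withDensity fun p => ENNReal.ofReal (dens C p) := by
  unfold hMeasure dens
  rw [restrict_withDensity', Measure.restrict_restrict_of_subset subset_rfl]

lemma conv (hC : BOC C) {h : Euc 2 → ℝ} (h0 : ∀ p, 0 ≤ h p)
    (hm : AEMeasurable h (volume.restrict C)) :
    ∫ p in C, h p ∂hMeasure C = (∫⁻ p in C, ENNReal.ofReal (h p * dens C p)).toReal := by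
  rw [hM_eq]
  have hac : ((volume.restrict C).withDensity fun p => ENNReal.ofReal (dens C p)) ≪
    volume.restrict C := withDensity_absolutelyContinuous _ _
  rw [integral_eq_lintegral_of_nonneg_ae (Eventually.of_forall h0)
    (hm.mono_ac hac).aestronglyMeasurable,
    lintegral_withDensity_eq_lintegral_mul₀ hC.dens_aem.ennreal_ofReal hm.ennreal_ofReal]
  congr 1
  apply lintegral_congr
  intro p
  rw [Pi.mul_apply, ENNReal.ofReal_mul (h0 p), mul_comm]

lemma rayleigh_ge (hC : BOC C) {L : ℝ} (hL : 1 < L) (hG : Grow L C) {f : Euc 2 → ℝ}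
    (hf : f ∈ testFuns C) : 1 / (4 * (8 * L) ^ 2) ≤ rayleigh C C f := by
  obtain ⟨⟨K, hK⟩, hne, hcs, hsub⟩ := hf
  have hmain := hC.plane_ineq hL hG hK hsub
  unfold rayleigh
  have hCm := hC.opn.measurableSet
  rw [hC.conv (fun p => sq_nonneg (f p)) (hK.continuous.pow 2).aemeasurable,
    hC.conv (fun p => sq_nonneg (dualNorm C p (fderiv ℝ f p))) ((hC.dual_aem f).pow_const 2)]
  set I1 := ∫⁻ p in C, ENNReal.ofReal (f p ^ 2 * dens C p) with hI1
  set I2 := ∫⁻ p in C, ENNReal.ofReal (dualNorm C p (fderiv ℝ f p) ^ 2 * dens C p) with hI2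
  have hcpt : IsCompact (tsupport f) := hcs
  have fin2 : I2 < ⊤ := by
    obtain ⟨M, hM⟩ := hcpt.exists_bound_of_continuousOn (hC.dens_cont.mono hsub)
    set R := (K * (3 * Metric.diam C)) ^ 2 * M with hR
    have : I2 ≤ ∫⁻ p in C, (tsupport f).indicator (fun _ => ENNReal.ofReal R) p := by
      apply setLIntegral_mono' hCm
      intro p hp
      by_cases hps : p ∈ tsupport f
      · rw [indicator_of_mem hps]
        apply ENNReal.ofReal_le_ofReal
        have a1 := hC.dual_le_norm hp (fderiv ℝ f p)
        have a2 : ‖fderiv ℝ f p‖ ≤ K := norm_fderiv_le_of_lipschitz ℝ hK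
        have a3 := hC.dual_nonneg hp (fderiv ℝ f p)
        have a4 := hM p hps
        have a5 := hC.dens_pos hp
        rw [Real.norm_of_nonneg a5.le] at a4
        have a6 : (0:ℝ) ≤ Metric.diam C := Metric.diam_nonneg
        have a7 : dualNorm C p (fderiv ℝ f p) ≤ K * (3 * Metric.diam C) :=
          a1.trans (by gcongr)
        rw [hR]
        gcongr
      · have : fderiv ℝ f p = 0 := by
          by_contra hcon
          exact hps (support_fderiv_subset ℝ hcon)
        rw [this, hC.dual_zero hp]
        simp
    refine this.trans_lt ?_
    refine (setLIntegral_le_lintegral _ _).trans_lt ?_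
    rw [lintegral_indicator_const hcpt.measurableSet]
    exact ENNReal.mul_lt_top ENNReal.ofReal_lt_top hcpt.measure_lt_top
  have fin1 : I1 < ⊤ := hmain.trans_lt (ENNReal.mul_lt_top ENNReal.ofReal_lt_top fin2)
  have pos1 : I1 ≠ 0 := by
    intro h0
    have hm1 : AEMeasurable (fun p => ENNReal.ofReal (f p ^ 2 * dens C p)) (volume.restrict C) :=
      ((hK.continuous.pow 2).aemeasurable.mul hC.dens_aem).ennreal_ofReal
    rw [hI1, lintegral_eq_zero_iff' hm1, EventuallyEq, ae_restrict_iff' hCm] at h0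
    obtain ⟨p, hp⟩ := Function.ne_iff.1 hne
    have ho : IsOpen {q | f q ≠ 0} := isOpen_ne_fun hK.continuous continuous_const
    have hpos := ho.measure_pos volume ⟨p, hp⟩
    refine hpos.ne' ?_
    refine measure_mono_null ?_ h0
    intro q hq hcon
    have hqC : q ∈ C := hsub (subset_tsupport f hq)
    have := hcon hqC
    simp only [Pi.zero_apply, ENNReal.ofReal_eq_zero] at this
    have h5 := hC.dens_pos hqC
    have h6 : 0 < f q ^ 2 := by
      have : f q ≠ 0 := hq
      positivity
    nlinarith [mul_pos h6 h5]
  have hp1 : 0 < I1.toReal := ENNReal.toReal_pos pos1 fin1.ne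
  have h2 := ENNReal.toReal_mono (ENNReal.mul_lt_top ENNReal.ofReal_lt_top fin2).ne hmain
  rw [ENNReal.toReal_mul, ENNReal.toReal_ofReal (by positivity)] at h2
  rw [div_le_div_iff₀ (by positivity) hp1]
  linarith

lemma testFuns_nonempty (hC : BOC C) (hne : C.Nonempty) : (testFuns C).Nonempty := by
  obtain ⟨p, hp⟩ := hne
  obtain ⟨r, hr, hb, -⟩ := hC.ball_sub hp
  have hts : tsupport (fun x : Euc 2 => max 0 (r / 2 - dist x p)) ⊆ Metric.closedBall p (r / 2) := by
    apply closure_minimal _ Metric.isClosed_closedBall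
    intro x hx
    by_contra hcon
    rw [Metric.mem_closedBall, not_le] at hcon
    apply hx
    exact max_eq_left (by linarith)
  refine ⟨fun x => max 0 (r / 2 - dist x p), ⟨1, ?_⟩, ?_, ?_, ?_⟩
  · have h1 : LipschitzWith 1 (fun x : Euc 2 => r / 2 - dist x p) := by
      refine LipschitzWith.of_dist_le_mul fun x y => ?_
      rw [NNReal.coe_one, one_mul, Real.dist_eq]
      have : r / 2 - dist x p - (r / 2 - dist y p) = -(dist x p - dist y p) := by ring
      rw [this, abs_neg]
      exact abs_dist_sub_le x y p
    exact h1.const_max 0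
  · intro h
    have := congrFun h p
    simp at this
    linarith
  · exact IsCompact.of_isClosed_subset (isCompact_closedBall p (r / 2)) (isClosed_tsupport _) hts
  · exact hts.trans ((Metric.closedBall_subset_ball (by linarith)).trans hb)

end BOC

theorem part1 (δ : ℝ) (hδ : 0 ≤ δ) : ∃ lam : ℝ, 0 < lam ∧ ∀ C : Set (Euc 2), Convex ℝ C → IsOpen C →
        Bornology.IsBounded C → C.Nonempty → IsDeltaHyp C δ → lambda1 C ≥ lam := by
  obtain ⟨L, hL, h⟩ := growth δ hδ
  refine ⟨1 / (4 * (8 * L) ^ 2), by positivity, fun C h1 h2 h3 h4 h5 => ?_⟩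
  have hC : BOC C := ⟨h1, h2, h3⟩
  have hG : Grow L C := h 2 C hC h5
  unfold lambda1 lambda1D
  apply le_csInf ((hC.testFuns_nonempty h4).image _)
  rintro _ ⟨f, hf, rfl⟩
  exact hC.rayleigh_ge hL hG hf

/-- for every `δ ≥ 0` there exists `λ > 0` such that every bounded open
convex `C ⊆ ℝ²` which is `δ`-hyperbolic satisfies `λ₁(C) ≥ λ`; in particular a Gromov
hyperbolic planar Hilbert geometry has `λ₁(C) > 0`. -/
theorem stmt9 :
    (∀ δ : ℝ, 0 ≤ δ → ∃ lam : ℝ, 0 < lam ∧ ∀ C : Set (Euc 2), Convex ℝ C → IsOpen C →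
        Bornology.IsBounded C → C.Nonempty → IsDeltaHyp C δ → lambda1 C ≥ lam) ∧
      ∀ C : Set (Euc 2), Convex ℝ C → IsOpen C → Bornology.IsBounded C → C.Nonempty →
        (∃ δ : ℝ, 0 ≤ δ ∧ IsDeltaHyp C δ) → 0 < lambda1 C := by
  exact ⟨part1, fun C h1 h2 h3 h4 ⟨δ, hδ, h5⟩ => by
    obtain ⟨lam, hl, h⟩ := part1 δ hδ
    exact hl.trans_le (h C h1 h2 h3 h4 h5)⟩
end

section
/- Let C be a bounded open convex subset of ℝⁿ with its Hilbert distance d_C and Hilbert measure μ_C. Then for every R > 0 and every metric ball B_R of radius R in (C, d_C), one has (ωₙ/(4e^{2nR}))·((e^{2R}−1)/(e^{2(R+1)}−1))ⁿ ≤ μ_C(B_R) ≤ ((e^{4R}−1)/2)ⁿ·ωₙ, where ωₙ is the Lebesgue volume of the Euclidean unit ball of ℝⁿ. In particular these bounds are independent of C and of the center of the ball. -/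
open MeasureTheory Set Filter
open scoped ENNReal NNReal

section Helpers

/-- `C` translated so that `p` becomes the origin. -/
def trs {n : ℕ} (C : Set (Euc n)) (p : Euc n) : Set (Euc n) := {w | p + w ∈ C}

/-- gauge of the translate -/
noncomputable def gg {n : ℕ} (C : Set (Euc n)) (p w : Euc n) : ℝ := gauge (trs C p) w

variable {n : ℕ} {C : Set (Euc n)}

lemma trs_convex (hconv : Convex ℝ C) (p : Euc n) : Convex ℝ (trs C p) :=
  hconv.translate_preimage_right p

lemma trs_open (hopen : IsOpen C) (p : Euc n) : IsOpen (trs C p) :=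
  hopen.preimage (continuous_const.add continuous_id)

lemma trs_nhds (hopen : IsOpen C) {p : Euc n} (hp : p ∈ C) : trs C p ∈ nhds (0 : Euc n) :=
  (trs_open hopen p).mem_nhds (by simpa [trs] using hp)

lemma trs_absorbent (hopen : IsOpen C) {p : Euc n} (hp : p ∈ C) : Absorbent ℝ (trs C p) :=
  absorbent_nhds_zero (trs_nhds hopen hp)

lemma trs_bdd (hbdd : Bornology.IsBounded C) (p : Euc n) : Bornology.IsBounded (trs C p) := by
  have h := hbdd.vadd (-p)
  refine h.subset ?_
  intro w hw
  exact ⟨p + w, hw, by simp⟩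

lemma gg_lt_one (hconv : Convex ℝ C) (hopen : IsOpen C) {p : Euc n} (hp : p ∈ C) (w : Euc n) :
    gg C p w < 1 ↔ p + w ∈ C := by
  have h := gauge_lt_one_eq_self_of_isOpen (trs_convex hconv p)
    (by simpa [trs] using hp) (trs_open hopen p)
  exact Set.ext_iff.1 h w

lemma gg_nonneg (p w : Euc n) : 0 ≤ gg C p w := gauge_nonneg _

lemma gg_smul {a : ℝ} (ha : 0 ≤ a) (p w : Euc n) : gg C p (a • w) = a * gg C p w := by
  simp [gg, gauge_smul_of_nonneg ha]

lemma gg_zero (p : Euc n) : gg C p 0 = 0 := gauge_zero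

lemma gg_pos (hopen : IsOpen C) (hbdd : Bornology.IsBounded C) {p : Euc n}
    (hp : p ∈ C) {w : Euc n} (hw : w ≠ 0) : 0 < gg C p w :=
  (gauge_pos (trs_absorbent hopen hp)
    ((NormedSpace.isVonNBounded_iff ℝ).2 (trs_bdd hbdd p))).2 hw

lemma gg_add (hconv : Convex ℝ C) (hopen : IsOpen C) {p : Euc n} (hp : p ∈ C) (v w : Euc n) :
    gg C p (v + w) ≤ gg C p v + gg C p w :=
  gauge_add_le (trs_convex hconv p) (trs_absorbent hopen hp) v w

lemma gg_cont (hconv : Convex ℝ C) (hopen : IsOpen C) {p : Euc n} (hp : p ∈ C) :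
    Continuous (gg C p) :=
  continuous_gauge (trs_convex hconv p) (trs_nhds hopen hp)

lemma lineParams_eq (hconv : Convex ℝ C) (hopen : IsOpen C) (hbdd : Bornology.IsBounded C)
    {p : Euc n} (hp : p ∈ C) {u : Euc n} (hu : u ≠ 0) :
    lineParams C p u = Ioo (-(1 / gg C p (-u))) (1 / gg C p u) := by
  have h1 := gg_pos hopen hbdd hp hu
  have h2 := gg_pos hopen hbdd hp (neg_ne_zero.2 hu)
  ext t
  have e : t ∈ lineParams C p u ↔ gg C p (t • u) < 1 := (gg_lt_one hconv hopen hp _).symm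
  rw [e, mem_Ioo]
  rcases le_total 0 t with ht | ht
  · rw [gg_smul ht, lt_div_iff₀ h1]
    have : -(1 / gg C p (-u)) < t := lt_of_lt_of_le (by simpa using h2) ht
    tauto
  · have : t • u = (-t) • (-u) := by simp
    rw [this, gg_smul (by linarith), neg_lt, lt_div_iff₀ h2]
    have : t < 1 / gg C p u := lt_of_le_of_lt ht (by positivity)
    tauto

lemma line_sup_inf (hconv : Convex ℝ C) (hopen : IsOpen C) (hbdd : Bornology.IsBounded C)
    {p : Euc n} (hp : p ∈ C) {u : Euc n} (hu : u ≠ 0) :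
    sSup (lineParams C p u) = 1 / gg C p u ∧ sInf (lineParams C p u) = -(1 / gg C p (-u)) := by
  have h1 := gg_pos hopen hbdd hp hu
  have h2 := gg_pos hopen hbdd hp (neg_ne_zero.2 hu)
  have h3 : -(1 / gg C p (-u)) < 1 / gg C p u := by
    have : 0 < 1 / gg C p u := by positivity
    have : 0 < 1 / gg C p (-u) := by positivity
    linarith
  rw [lineParams_eq hconv hopen hbdd hp hu]
  exact ⟨csSup_Ioo h3, csInf_Ioo h3⟩

lemma fNorm_eq (hconv : Convex ℝ C) (hopen : IsOpen C) (hbdd : Bornology.IsBounded C)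
    {p : Euc n} (hp : p ∈ C) (u : Euc n) :
    fNorm C p u = (gg C p u + gg C p (-u)) / 2 := by
  unfold fNorm
  split_ifs with hu
  · subst hu; simp [gg_zero]
  · obtain ⟨a, b⟩ := line_sup_inf hconv hopen hbdd hp hu
    rw [a, b]
    simp
    ring

lemma hBall_iff (hconv : Convex ℝ C) (hopen : IsOpen C) (hbdd : Bornology.IsBounded C)
    {p : Euc n} (hp : p ∈ C) (u : Euc n) {R : ℝ} (hR : 0 < R) :
    p + u ∈ hBall C p R ↔
      gg C p (-u) + Real.exp (2 * R) * gg C p u < Real.exp (2 * R) - 1 := by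
  have hE : 1 < Real.exp (2 * R) := by simpa using hR
  have key : p + u ∈ hBall C p R ↔ gg C p u < 1 ∧ hDist C p (p + u) < R := by
    rw [gg_lt_one hconv hopen hp]; rfl
  rw [key]
  by_cases hu : u = 0
  · subst hu
    simp [gg_zero, hDist, hR]
  have h1 := gg_pos hopen hbdd hp hu
  have h2 := gg_pos hopen hbdd hp (neg_ne_zero.2 hu)
  obtain ⟨a, b⟩ := line_sup_inf hconv hopen hbdd hp hu
  have hne : p ≠ p + u := by simpa using hu
  unfold hDist
  rw [if_neg hne, add_sub_cancel_left, a, b]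
  set s := gg C p (-u)
  set t := gg C p u
  by_cases ht : t < 1
  · have e : ((1 - -(1 / s)) * (1 / t)) / (- -(1 / s) * (1 / t - 1)) = (1 + s) / (1 - t) := by
      have : 1 - t ≠ 0 := by linarith
      have : 1 / t - 1 = (1 - t) / t := by field_simp
      rw [this]
      field_simp
      ring
    rw [e]
    have hpos : 0 < (1 + s) / (1 - t) := div_pos (by linarith) (by linarith)
    have : (1 / 2 * Real.log ((1 + s) / (1 - t)) < R) ↔
        Real.log ((1 + s) / (1 - t)) < 2 * R := by constructor <;> intro h <;> linarith
    rw [this, Real.log_lt_iff_lt_exp hpos, div_lt_iff₀ (by linarith)]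
    constructor
    · rintro ⟨_, h⟩; linarith
    · intro h; exact ⟨ht, by linarith⟩
  · constructor
    · rintro ⟨h, _⟩; exact absurd h ht
    · intro h; exfalso; nlinarith

lemma mem_tb (hconv : Convex ℝ C) (hopen : IsOpen C) (hbdd : Bornology.IsBounded C)
    {p : Euc n} (hp : p ∈ C) (u : Euc n) (r : ℝ) :
    u ∈ tangentBall C p r ↔ gg C p u + gg C p (-u) < 2 * r := by
  unfold tangentBall
  rw [mem_setOf_eq, fNorm_eq hconv hopen hbdd hp]
  constructor <;> intro h <;> linarith

lemma tb_open (hconv : Convex ℝ C) (hopen : IsOpen C) (hbdd : Bornology.IsBounded C)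
    {p : Euc n} (hp : p ∈ C) (r : ℝ) : IsOpen (tangentBall C p r) := by
  have : tangentBall C p r = {u | gg C p u + gg C p (-u) < 2 * r} := by
    ext u; exact mem_tb hconv hopen hbdd hp u r
  rw [this]
  have hc := gg_cont hconv hopen hp
  exact isOpen_lt (hc.add (hc.comp continuous_neg)) continuous_const

lemma tb_smul (hconv : Convex ℝ C) (hopen : IsOpen C) (hbdd : Bornology.IsBounded C)
    {p : Euc n} (hp : p ∈ C) {r : ℝ} (hr : 0 < r) :
    volume (tangentBall C p r) = ENNReal.ofReal (r ^ n) * volume (tangentBall C p 1) := by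
  have h : (fun u : Euc n => r • u) ⁻¹' tangentBall C p r = tangentBall C p 1 := by
    ext u
    rw [mem_preimage, mem_tb hconv hopen hbdd hp, mem_tb hconv hopen hbdd hp, ← smul_neg,
      gg_smul hr.le, gg_smul hr.le]
    constructor <;> intro h <;> nlinarith
  have h2 := Measure.addHaar_preimage_smul (volume : Measure (Euc n)) hr.ne' (tangentBall C p r)
  rw [h] at h2
  rw [h2, ← mul_assoc, ← ENNReal.ofReal_mul (by positivity)]
  simp only [finrank_euclideanSpace, Fintype.card_fin]
  rw [abs_of_pos (by positivity), mul_inv_cancel₀ (by positivity)]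
  simp

lemma tb_pos (hconv : Convex ℝ C) (hopen : IsOpen C) (hbdd : Bornology.IsBounded C)
    {p : Euc n} (hp : p ∈ C) : volume (tangentBall C p 1) ≠ 0 :=
  ((tb_open hconv hopen hbdd hp 1).measure_pos volume
    ⟨0, (mem_tb hconv hopen hbdd hp 0 1).2 (by simp [gg_zero])⟩).ne'

lemma tb_fin (hconv : Convex ℝ C) (hopen : IsOpen C) (hbdd : Bornology.IsBounded C)
    {p : Euc n} (hp : p ∈ C) : volume (tangentBall C p 1) ≠ ⊤ := by
  have h2 : volume (tangentBall C p (1 / 2)) ≠ ⊤ := by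
    refine (((trs_bdd hbdd p).subset ?_).measure_lt_top).ne
    intro u hu
    rw [mem_tb hconv hopen hbdd hp] at hu
    have := gg_nonneg (C := C) p (-u)
    exact (gg_lt_one hconv hopen hp u).1 (by linarith)
  rw [tb_smul hconv hopen hbdd hp (by norm_num)] at h2
  intro h
  rw [h] at h2
  apply h2
  rw [ENNReal.mul_top]
  simp

/-- the gauge comparison criterion -/
lemma gg_le_of (hconv : Convex ℝ C) (hopen : IsOpen C) {p q : Euc n} (hp : p ∈ C) (hq : q ∈ C)
    {c : ℝ} (hc : 0 < c) (h : ∀ w, gg C p w < 1 → gg C q w ≤ c) (w : Euc n) :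
    gg C q w ≤ c * gg C p w := by
  refine le_of_forall_pos_le_add fun ε hε => ?_
  set a := gg C p w + ε / c with ha
  have hapos : 0 < a := by have := gg_nonneg (C := C) p w; positivity
  have h1 : gg C p (a⁻¹ • w) < 1 := by
    rw [gg_smul (by positivity), inv_mul_lt_iff₀ hapos]
    have : 0 < ε / c := by positivity
    linarith
  have h2 := h _ h1
  rw [gg_smul (by positivity), inv_mul_le_iff₀ hapos] at h2
  have : a * c = c * gg C p w + ε := by rw [ha]; field_simp
  linarith

lemma gg_compare (hconv : Convex ℝ C) (hopen : IsOpen C) (hbdd : Bornology.IsBounded C)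
    {p q : Euc n} (hp : p ∈ C) {R : ℝ} (hR : 0 < R) (hq : q ∈ hBall C p R) (w : Euc n) :
    gg C q w ≤ Real.exp (2 * R) * gg C p w ∧ gg C p w ≤ Real.exp (2 * R) * gg C q w := by
  have hqC : q ∈ C := hq.1
  obtain ⟨u, rfl⟩ : ∃ u, q = p + u := ⟨q - p, by simp⟩
  have hB := (hBall_iff hconv hopen hbdd hp u hR).1 hq
  have hE : 0 < Real.exp (2 * R) := Real.exp_pos _
  have n1 := gg_nonneg (C := C) p u
  have n2 := gg_nonneg (C := C) p (-u)
  constructor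
  · refine gg_le_of hconv hopen hp hqC hE (fun v hv => ?_) w
    have h1 : gg C (p + u) ((Real.exp (2 * R))⁻¹ • v) < 1 := by
      rw [gg_lt_one hconv hopen hqC, add_assoc, ← gg_lt_one hconv hopen hp]
      refine (gg_add hconv hopen hp _ _).trans_lt ?_
      rw [gg_smul (by positivity)]
      have : (Real.exp (2 * R))⁻¹ * gg C p v < (Real.exp (2 * R))⁻¹ :=
        mul_lt_of_lt_one_right (by positivity) hv
      have h3 : gg C p u < 1 - (Real.exp (2 * R))⁻¹ := by
        have : 1 - (Real.exp (2 * R))⁻¹ = (Real.exp (2 * R) - 1) / Real.exp (2 * R) := by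
          field_simp
        rw [this, lt_div_iff₀ hE]; linarith
      linarith
    rw [gg_smul (by positivity), inv_mul_lt_iff₀ hE] at h1
    linarith
  · refine gg_le_of hconv hopen hqC hp hE (fun v hv => ?_) w
    rw [gg_lt_one hconv hopen hqC, add_assoc, ← gg_lt_one hconv hopen hp] at hv
    have h := gg_add hconv hopen hp (u + v) (-u)
    rw [show u + v + -u = v by abel] at h
    nlinarith

lemma tb_compare (hconv : Convex ℝ C) (hopen : IsOpen C) (hbdd : Bornology.IsBounded C)
    {p q : Euc n} (hp : p ∈ C) (hq : q ∈ C) {c : ℝ} (hc : 0 < c)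
    (h : ∀ w, gg C q w ≤ c * gg C p w) :
    (volume (tangentBall C p 1)).toReal ≤ c ^ n * (volume (tangentBall C q 1)).toReal := by
  have h1 : tangentBall C p 1 ⊆ tangentBall C q c := by
    intro u hu
    rw [mem_tb hconv hopen hbdd hp] at hu
    rw [mem_tb hconv hopen hbdd hq]
    have := h u
    have := h (-u)
    nlinarith
  have h2 := measure_mono (μ := volume) h1
  rw [tb_smul hconv hopen hbdd hq hc] at h2
  have h3 := ENNReal.toReal_mono
    (ENNReal.mul_ne_top ENNReal.ofReal_ne_top (tb_fin hconv hopen hbdd hq)) h2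
  rwa [ENNReal.toReal_mul, ENNReal.toReal_ofReal (by positivity)] at h3

lemma hBall_meas (hconv : Convex ℝ C) (hopen : IsOpen C) (hbdd : Bornology.IsBounded C)
    {p : Euc n} (hp : p ∈ C) {R : ℝ} (hR : 0 < R) : MeasurableSet (hBall C p R) := by
  have : hBall C p R = {y | gg C p (-(y - p)) + Real.exp (2 * R) * gg C p (y - p)
      < Real.exp (2 * R) - 1} := by
    ext y
    rw [mem_setOf_eq, ← hBall_iff hconv hopen hbdd hp _ hR]
    simp
  rw [this]
  have hc := gg_cont hconv hopen hp
  refine (isOpen_lt ?_ continuous_const).measurableSet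
  fun_prop

lemma hBall_vol (hconv : Convex ℝ C) (hopen : IsOpen C) (hbdd : Bornology.IsBounded C)
    {p : Euc n} (hp : p ∈ C) {R : ℝ} (hR : 0 < R) :
    ENNReal.ofReal (((Real.exp (2 * R) - 1) / (2 * Real.exp (2 * R))) ^ n)
        * volume (tangentBall C p 1) ≤ volume (hBall C p R) ∧
    volume (hBall C p R) ≤
      ENNReal.ofReal (((Real.exp (2 * R) - 1) / 2) ^ n) * volume (tangentBall C p 1) := by
  have hE : 1 < Real.exp (2 * R) := by simpa using hR
  have h0 : volume (hBall C p R) = volume ((fun u => p + u) ⁻¹' hBall C p R) :=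
    (measure_preimage_add _ _ _).symm
  rw [h0, ← tb_smul hconv hopen hbdd hp (div_pos (by linarith) (by linarith)),
    ← tb_smul hconv hopen hbdd hp (div_pos (by linarith) (by linarith))]
  constructor
  · refine measure_mono fun u hu => ?_
    rw [mem_tb hconv hopen hbdd hp] at hu
    rw [mem_preimage, hBall_iff hconv hopen hbdd hp _ hR]
    have n1 := gg_nonneg (C := C) p u
    have n2 := gg_nonneg (C := C) p (-u)
    have : 2 * ((Real.exp (2 * R) - 1) / (2 * Real.exp (2 * R)))
        = (Real.exp (2 * R) - 1) / Real.exp (2 * R) := by field_simp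
    rw [this, lt_div_iff₀ (by linarith)] at hu
    nlinarith
  · refine measure_mono fun u hu => ?_
    rw [mem_tb hconv hopen hbdd hp]
    rw [mem_preimage, hBall_iff hconv hopen hbdd hp _ hR] at hu
    have n1 := gg_nonneg (C := C) p u
    nlinarith

end Helpers

/-- volume bounds for metric balls of Hilbert geometries, independent of
`C` and of the center:
`ωₙ/(4e^{2nR})·((e^{2R}-1)/(e^{2(R+1)}-1))ⁿ ≤ μ_C(B_R) ≤ ((e^{4R}-1)/2)ⁿ·ωₙ`. -/
theorem stmt10 {n : ℕ} (C : Set (Euc n)) (hconv : Convex ℝ C) (hopen : IsOpen C)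
    (hbdd : Bornology.IsBounded C) (hne : C.Nonempty)
    (x : Euc n) (hx : x ∈ C) (R : ℝ) (hR : 0 < R) :
    omegaVol n / (4 * Real.exp (2 * n * R)) *
        ((Real.exp (2 * R) - 1) / (Real.exp (2 * (R + 1)) - 1)) ^ n ≤
      (hMeasure C (hBall C x R)).toReal ∧
    (hMeasure C (hBall C x R)).toReal ≤ ((Real.exp (4 * R) - 1) / 2) ^ n * omegaVol n := by
  have hE : 1 < Real.exp (2 * R) := by simpa using hR
  set E := Real.exp (2 * R) with hEdef
  have hE0 : 0 < E := by linarith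
  have hω : 0 ≤ omegaVol n := ENNReal.toReal_nonneg
  have hfin := tb_fin hconv hopen hbdd hx
  set V := (volume (tangentBall C x 1)).toReal with hV
  have hVpos : 0 < V := ENNReal.toReal_pos (tb_pos hconv hopen hbdd hx) hfin
  have hVe : volume (tangentBall C x 1) = ENNReal.ofReal V := (ENNReal.ofReal_toReal hfin).symm
  have hmeas := hBall_meas hconv hopen hbdd hx hR
  obtain ⟨hlo, hup⟩ := hBall_vol hconv hopen hbdd hx hR
  rw [← hEdef, hVe, ← ENNReal.ofReal_mul (pow_nonneg (div_nonneg (by linarith) (by linarith)) n)]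
    at hlo hup
  have hsub : hBall C x R ⊆ C := fun y hy => hy.1
  have hint : hMeasure C (hBall C x R) = ∫⁻ y in hBall C x R,
      ENNReal.ofReal (omegaVol n / (volume (tangentBall C y 1)).toReal) := by
    unfold hMeasure
    rw [withDensity_apply _ hmeas, Measure.restrict_restrict hmeas,
      inter_eq_self_of_subset_left hsub]
  have hdens : ∀ y ∈ hBall C x R,
      omegaVol n / (E ^ n * V) ≤ omegaVol n / (volume (tangentBall C y 1)).toReal ∧
      omegaVol n / (volume (tangentBall C y 1)).toReal ≤ E ^ n * omegaVol n / V := by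
    intro y hy
    have hyp : 0 < (volume (tangentBall C y 1)).toReal :=
      ENNReal.toReal_pos (tb_pos hconv hopen hbdd hy.1) (tb_fin hconv hopen hbdd hy.1)
    have c1 := tb_compare hconv hopen hbdd hx hy.1 hE0
      (fun w => (gg_compare hconv hopen hbdd hx hR hy w).1)
    have c2 := tb_compare hconv hopen hbdd hy.1 hx hE0
      (fun w => (gg_compare hconv hopen hbdd hx hR hy w).2)
    constructor
    · exact div_le_div_of_nonneg_left hω hyp c2
    · rw [div_le_div_iff₀ hyp hVpos]
      nlinarith [mul_le_mul_of_nonneg_left c1 hω]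
  have U : hMeasure C (hBall C x R) ≤
      ENNReal.ofReal (E ^ n * omegaVol n / V * (((E - 1) / 2) ^ n * V)) := by
    rw [hint, ENNReal.ofReal_mul (by positivity)]
    calc _ ≤ ∫⁻ y in hBall C x R, ENNReal.ofReal (E ^ n * omegaVol n / V) :=
          setLIntegral_mono' hmeas fun y hy => ENNReal.ofReal_le_ofReal (hdens y hy).2
      _ = ENNReal.ofReal (E ^ n * omegaVol n / V) * volume (hBall C x R) := by
          rw [setLIntegral_const]
      _ ≤ _ := by gcongr
  have L : ENNReal.ofReal (omegaVol n / (E ^ n * V) * (((E - 1) / (2 * E)) ^ n * V)) ≤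
      hMeasure C (hBall C x R) := by
    rw [hint, ENNReal.ofReal_mul (by positivity)]
    calc _ ≤ ENNReal.ofReal (omegaVol n / (E ^ n * V)) * volume (hBall C x R) := by gcongr
      _ = ∫⁻ y in hBall C x R, ENNReal.ofReal (omegaVol n / (E ^ n * V)) := by
          rw [setLIntegral_const]
      _ ≤ _ := setLIntegral_mono' hmeas fun y hy => ENNReal.ofReal_le_ofReal (hdens y hy).1
  have hq0 : 0 ≤ (E - 1) / (2 * E) := div_nonneg (by linarith) (by linarith)
  have hq1 : 0 ≤ (E - 1) / 2 := by linarith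
  have e4 : Real.exp (4 * R) = E * E := by rw [hEdef, ← Real.exp_add]; ring_nf
  have en : Real.exp (2 * n * R) = E ^ n := by rw [hEdef, ← Real.exp_nat_mul]; ring_nf
  have e2 : 4 * E ≤ Real.exp (2 * (R + 1)) := by
    have h1 : Real.exp (2 * (R + 1)) = E * (Real.exp 1 * Real.exp 1) := by
      rw [hEdef, ← Real.exp_add, ← Real.exp_add]; ring_nf
    have h2 : 2 ≤ Real.exp 1 := by have := Real.add_one_le_exp (1 : ℝ); linarith
    rw [h1]; nlinarith [mul_le_mul h2 h2 (by norm_num) (by linarith)]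
  constructor
  · have L2 := ENNReal.toReal_mono (ne_top_of_le_ne_top ENNReal.ofReal_ne_top U) L
    rw [ENNReal.toReal_ofReal (by positivity)] at L2
    refine le_trans ?_ L2
    have : omegaVol n / (E ^ n * V) * (((E - 1) / (2 * E)) ^ n * V) =
        omegaVol n / E ^ n * ((E - 1) / (2 * E)) ^ n := by field_simp
    rw [this, en]
    have hpE : 0 < E ^ n := by positivity
    have hb : (E - 1) / (Real.exp (2 * (R + 1)) - 1) ≤ (E - 1) / (2 * E) :=
      div_le_div_of_nonneg_left (by linarith) (by linarith) (by linarith)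
    have hb0 : 0 ≤ (E - 1) / (Real.exp (2 * (R + 1)) - 1) :=
      div_nonneg (by linarith) (by linarith)
    refine mul_le_mul ?_ (pow_le_pow_left₀ hb0 hb n) (pow_nonneg hb0 n) (by positivity)
    exact div_le_div_of_nonneg_left hω hpE (by linarith)
  · have U2 := ENNReal.toReal_mono ENNReal.ofReal_ne_top U
    rw [ENNReal.toReal_ofReal (by positivity)] at U2
    refine U2.trans ?_
    have : E ^ n * omegaVol n / V * (((E - 1) / 2) ^ n * V) =
        (E * ((E - 1) / 2)) ^ n * omegaVol n := by rw [mul_pow]; field_simp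
    rw [this, e4]
    refine mul_le_mul_of_nonneg_right (pow_le_pow_left₀ (by positivity) (by nlinarith) n) hω
end

section
/- Let C be a bounded open convex subset of ℝⁿ, x ∈ C, and R > 0. Then ((e^{2R}−1)/(2Re^{2R}))ⁿ ≤ vol_e(B_R(x)) / vol_e(TB_R(x)) ≤ ((e^{2R}−1)/(2R))ⁿ, where B_R(x) = {y ∈ C : d_C(x,y) < R} is the metric ball for the Hilbert distance, TB_R(x) = {u ∈ ℝⁿ : ‖u‖_{C,x} < R} is the tangent ball of radius R at x for the Hilbert Finsler norm, and vol_e is Lebesgue measure. -/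
open MeasureTheory Set Filter
open scoped ENNReal NNReal

section aux
open scoped Pointwise
variable {n : ℕ} {C : Set (Euc n)} {x : Euc n}

lemma lp_zero (hx : x ∈ C) (u : Euc n) : (0 : ℝ) ∈ lineParams C x u := by
  simpa [lineParams] using hx

lemma lp_bdd (hbdd : Bornology.IsBounded C) {u : Euc n} (hu : u ≠ 0) :
    ∃ M : ℝ, ∀ t ∈ lineParams C x u, |t| ≤ M := by
  obtain ⟨M, hM⟩ := hbdd.exists_norm_le
  have hu' : 0 < ‖u‖ := norm_pos_iff.2 hu
  refine ⟨(M + ‖x‖) / ‖u‖, fun t ht => ?_⟩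
  rw [le_div_iff₀ hu', ← Real.norm_eq_abs, ← norm_smul]
  calc ‖t • u‖ = ‖(x + t • u) - x‖ := by simp
    _ ≤ ‖x + t • u‖ + ‖x‖ := norm_sub_le _ _
    _ ≤ M + ‖x‖ := by gcongr; exact hM _ ht

lemma lp_above (hbdd : Bornology.IsBounded C) {u : Euc n} (hu : u ≠ 0) :
    BddAbove (lineParams C x u) := by
  obtain ⟨M, hM⟩ := lp_bdd (x := x) hbdd hu
  exact ⟨M, fun t ht => (abs_le.1 (hM t ht)).2⟩

lemma lp_below (hbdd : Bornology.IsBounded C) {u : Euc n} (hu : u ≠ 0) :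
    BddBelow (lineParams C x u) := by
  obtain ⟨M, hM⟩ := lp_bdd (x := x) hbdd hu
  exact ⟨-M, fun t ht => (abs_le.1 (hM t ht)).1⟩

lemma lp_open (hopen : IsOpen C) (u : Euc n) : IsOpen (lineParams C x u) :=
  hopen.preimage (f := fun t : ℝ => x + t • u) (by fun_prop)

lemma lp_lt_sup (hopen : IsOpen C) (hbdd : Bornology.IsBounded C) {u : Euc n} (hu : u ≠ 0)
    {t : ℝ} (ht : t ∈ lineParams C x u) : t < sSup (lineParams C x u) := by
  obtain ⟨e, he, hb⟩ := Metric.isOpen_iff.1 (lp_open hopen u) t ht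
  have : t + e / 2 ∈ lineParams C x u := hb (by
    rw [Metric.mem_ball, Real.dist_eq, add_sub_cancel_left, abs_of_pos (by linarith)]; linarith)
  linarith [le_csSup (lp_above hbdd hu) this]

lemma lp_inf_lt (hopen : IsOpen C) (hbdd : Bornology.IsBounded C) {u : Euc n} (hu : u ≠ 0)
    {t : ℝ} (ht : t ∈ lineParams C x u) : sInf (lineParams C x u) < t := by
  obtain ⟨e, he, hb⟩ := Metric.isOpen_iff.1 (lp_open hopen u) t ht
  have : t - e / 2 ∈ lineParams C x u := hb (by
    rw [Metric.mem_ball, Real.dist_eq, sub_sub_cancel_left, abs_neg, abs_of_pos (by linarith)]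
    linarith)
  linarith [csInf_le (lp_below hbdd hu) this]

lemma lp_mem (hconv : Convex ℝ C) (hx : x ∈ C) {u : Euc n}
    {t : ℝ} (h0 : 0 ≤ t) (ht : t < sSup (lineParams C x u)) : t ∈ lineParams C x u := by
  obtain ⟨s, hs, hts⟩ := exists_lt_of_lt_csSup ⟨0, lp_zero hx u⟩ ht
  have hs0 : 0 < s := by linarith
  have h := hconv.add_smul_mem (x := x) (y := s • u) hx hs (t := t / s)
    ⟨by positivity, by rw [div_le_one hs0]; linarith⟩
  rwa [smul_smul, div_mul_cancel₀ _ hs0.ne'] at h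

lemma fNorm_smul {c : ℝ} (hc : 0 < c) (u : Euc n) : fNorm C x (c • u) = c * fNorm C x u := by
  by_cases hu : u = 0
  · simp [fNorm, hu]
  have h : lineParams C x u = c • lineParams C x (c • u) := by
    ext t
    rw [Set.mem_smul_set_iff_inv_smul_mem₀ hc.ne']
    simp only [lineParams, mem_ofPred_eq, smul_eq_mul, smul_smul]
    rw [show c⁻¹ * t * c = t by field_simp]
  have h1 := congrArg sSup h
  have h2 := congrArg sInf h
  rw [Real.sSup_smul_of_nonneg hc.le, smul_eq_mul] at h1
  rw [Real.sInf_smul_of_nonneg hc.le, smul_eq_mul] at h2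
  rw [fNorm, fNorm, if_neg hu, if_neg (smul_ne_zero hc.ne' hu), h1, h2]
  generalize sSup (lineParams C x (c • u)) = a
  generalize sInf (lineParams C x (c • u)) = b
  simp only [one_div, mul_inv]
  field_simp

lemma hDist_lt (hopen : IsOpen C) (hbdd : Bornology.IsBounded C) (hx : x ∈ C) {v : Euc n}
    (hv : v ≠ 0) (hy : x + v ∈ C) (R : ℝ) :
    hDist C x (x + v) < R ↔
      -1 / sInf (lineParams C x v) + Real.exp (2 * R) * (1 / sSup (lineParams C x v)) <
        Real.exp (2 * R) - 1 := by
  have hne : x ≠ x + v := by simpa using hv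
  have h1 : (1 : ℝ) ∈ lineParams C x v := by simpa [lineParams] using hy
  have hs := lp_lt_sup hopen hbdd hv h1
  have hi := lp_inf_lt hopen hbdd hv (lp_zero hx v)
  rw [hDist, if_neg hne, add_sub_cancel_left]
  generalize sSup (lineParams C x v) = a at *
  generalize sInf (lineParams C x v) = b at *
  have hb : 0 < -b := by linarith
  have ha : 0 < a - 1 := by linarith
  have ha0 : 0 < a := by linarith
  have hpos : 0 < (1 - b) * a / (-b * (a - 1)) := by
    have : 0 < 1 - b := by linarith
    positivity
  rw [show (1 / 2 * Real.log ((1 - b) * a / (-b * (a - 1))) < R) ↔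
    Real.log ((1 - b) * a / (-b * (a - 1))) < 2 * R by constructor <;> intro h <;> linarith,
    Real.log_lt_iff_lt_exp hpos, div_lt_iff₀ (by positivity)]
  generalize Real.exp (2 * R) = E
  have key : E * (-b * (a - 1)) - (1 - b) * a =
      (-b * a) * ((E - 1) - (-1 / b + E * (1 / a))) := by
    have : b ≠ 0 := by linarith
    field_simp
    ring
  have hba : 0 < -b * a := by positivity
  rw [← sub_pos, key, mul_pos_iff_of_pos_left hba, sub_pos]

lemma fNorm_le {r : ℝ} (hr : 0 < r) (hbdd : Bornology.IsBounded C)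
    (hb : Metric.ball x r ⊆ C) (u : Euc n) : fNorm C x u ≤ 2 * ‖u‖ / r := by
  by_cases hu : u = 0
  · simp [fNorm, hu]
  have hu' : 0 < ‖u‖ := norm_pos_iff.2 hu
  have hm : ∀ t : ℝ, |t| = r / (2 * ‖u‖) → t ∈ lineParams C x u := by
    intro t ht
    apply hb
    rw [Metric.mem_ball, dist_eq_norm, add_sub_cancel_left, norm_smul, Real.norm_eq_abs, ht]
    field_simp
    linarith
  have hp : 0 < r / (2 * ‖u‖) := by positivity
  have h1 := le_csSup (lp_above hbdd hu) (hm _ (abs_of_pos hp))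
  have h2 := csInf_le (lp_below hbdd hu) (hm (-(r / (2 * ‖u‖))) (by rw [abs_neg, abs_of_pos hp]))
  rw [fNorm, if_neg hu]
  have h3 := one_div_le_one_div_of_le hp h1
  have h4 := one_div_le_one_div_of_le hp (le_neg_of_le_neg h2)
  rw [one_div_neg_eq_neg_one_div] at h4
  rw [one_div_div] at h3 h4
  linarith

lemma sub_upper (hopen : IsOpen C) (hbdd : Bornology.IsBounded C) (hx : x ∈ C)
    {R : ℝ} (hR : 0 < R) :
    hBall C x R ⊆ (fun v => x + v) '' (((Real.exp (2 * R) - 1) / (2 * R)) • tangentBall C x R) := by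
  rintro y ⟨hy, hd⟩
  have hE : 1 < Real.exp (2 * R) := Real.one_lt_exp_iff.2 (by linarith)
  have hc : 0 < (Real.exp (2 * R) - 1) / (2 * R) := div_pos (by linarith) (by linarith)
  refine ⟨y - x, ?_, by simp⟩
  rw [Set.mem_smul_set_iff_inv_smul_mem₀ hc.ne']
  change fNorm C x _ < R
  rw [fNorm_smul (inv_pos.2 hc), inv_mul_lt_iff₀ hc,
    show (Real.exp (2 * R) - 1) / (2 * R) * R = (Real.exp (2 * R) - 1) / 2 by field_simp]
  obtain ⟨v, rfl⟩ : ∃ v, y = x + v := ⟨y - x, by simp⟩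
  rw [add_sub_cancel_left]
  by_cases hv : v = 0
  · simp only [fNorm, hv, if_true]; linarith
  rw [hDist_lt hopen hbdd hx hv hy] at hd
  rw [fNorm, if_neg hv]
  have hs : 0 < 1 / sSup (lineParams C x v) :=
    one_div_pos.2 (lp_lt_sup hopen hbdd hv (lp_zero hx v))
  rw [neg_div] at hd
  nlinarith

lemma sub_lower (hconv : Convex ℝ C) (hopen : IsOpen C) (hbdd : Bornology.IsBounded C)
    (hx : x ∈ C) {R : ℝ} (hR : 0 < R) :
    (fun v => x + v) '' (((Real.exp (2 * R) - 1) / (2 * R * Real.exp (2 * R))) • tangentBall C x R)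
      ⊆ hBall C x R := by
  rintro y ⟨v, hvm, rfl⟩
  have hE : 1 < Real.exp (2 * R) := Real.one_lt_exp_iff.2 (by linarith)
  have hc : 0 < (Real.exp (2 * R) - 1) / (2 * R * Real.exp (2 * R)) :=
    div_pos (by linarith) (by positivity)
  rw [Set.mem_smul_set_iff_inv_smul_mem₀ hc.ne'] at hvm
  change fNorm C x _ < R at hvm
  rw [fNorm_smul (inv_pos.2 hc), inv_mul_lt_iff₀ hc,
    show (Real.exp (2 * R) - 1) / (2 * R * Real.exp (2 * R)) * R =
      (Real.exp (2 * R) - 1) / Real.exp (2 * R) / 2 by field_simp] at hvm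
  change x + v ∈ C ∧ hDist C x (x + v) < R
  by_cases hv : v = 0
  · simp [hDist, hv, hx, hR]
  have hs0 := lp_lt_sup hopen hbdd hv (lp_zero hx v)
  have hs : 0 < 1 / sSup (lineParams C x v) := one_div_pos.2 hs0
  have hi : 1 / sInf (lineParams C x v) < 0 :=
    one_div_neg.2 (lp_inf_lt hopen hbdd hv (lp_zero hx v))
  rw [fNorm, if_neg hv] at hvm
  have h2 : 1 / sSup (lineParams C x v) - 1 / sInf (lineParams C x v) <
    (Real.exp (2 * R) - 1) / Real.exp (2 * R) := by linarith
  rw [lt_div_iff₀ (by linarith)] at h2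
  have hlt : 1 / sSup (lineParams C x v) < 1 := by nlinarith
  rw [div_lt_one hs0] at hlt
  have hy : x + v ∈ C := by simpa [lineParams] using lp_mem hconv hx zero_le_one hlt
  refine ⟨hy, ?_⟩
  rw [hDist_lt hopen hbdd hx hv hy, neg_div]
  nlinarith

lemma vol_img (c : ℝ) (hc : 0 < c) (S : Set (Euc n)) :
    volume ((fun v => x + v) '' (c • S)) = ENNReal.ofReal (c ^ n) * volume S := by
  rw [Set.image_add_left, measure_preimage_add, Measure.addHaar_smul]
  simp [abs_of_pos hc]

end aux

/-- comparison of the Lebesgue volumes of the metric ball `B_R(x)` and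
the tangent ball `TB_R(x)`:
`((e^{2R}-1)/(2Re^{2R}))ⁿ ≤ vol_e(B_R(x))/vol_e(TB_R(x)) ≤ ((e^{2R}-1)/(2R))ⁿ`. -/
theorem stmt11 {n : ℕ} (C : Set (Euc n)) (hconv : Convex ℝ C) (hopen : IsOpen C)
    (hbdd : Bornology.IsBounded C) (hne : C.Nonempty)
    (x : Euc n) (hx : x ∈ C) (R : ℝ) (hR : 0 < R) :
    ((Real.exp (2 * R) - 1) / (2 * R * Real.exp (2 * R))) ^ n ≤
        (volume (hBall C x R)).toReal / (volume (tangentBall C x R)).toReal ∧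
      (volume (hBall C x R)).toReal / (volume (tangentBall C x R)).toReal ≤
        ((Real.exp (2 * R) - 1) / (2 * R)) ^ n := by
  have hE : 1 < Real.exp (2 * R) := Real.one_lt_exp_iff.2 (by linarith)
  have hc : 0 < (Real.exp (2 * R) - 1) / (2 * R) := div_pos (by linarith) (by linarith)
  have hc' : 0 < (Real.exp (2 * R) - 1) / (2 * R * Real.exp (2 * R)) :=
    div_pos (by linarith) (by positivity)
  have hU := measure_mono (μ := volume) (sub_upper hopen hbdd hx hR)
  have hL := measure_mono (μ := volume) (sub_lower hconv hopen hbdd hx hR)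
  rw [vol_img _ hc] at hU
  rw [vol_img _ hc'] at hL
  have hB : volume (hBall C x R) ≠ ⊤ :=
    (hbdd.subset (fun y hy => hy.1 : hBall C x R ⊆ C)).measure_lt_top.ne
  have hT : volume (tangentBall C x R) ≠ ⊤ := by
    intro h
    rw [h, ENNReal.mul_top (by simpa using pow_pos hc' n)] at hL
    exact hB (top_le_iff.1 hL)
  have hT0 : volume (tangentBall C x R) ≠ 0 := by
    obtain ⟨r, hr, hb⟩ := Metric.isOpen_iff.1 hopen x hx
    have hsub : Metric.ball (0 : Euc n) (R * r / 2) ⊆ tangentBall C x R := by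
      intro u hu
      rw [mem_ball_zero_iff] at hu
      refine (fNorm_le hr hbdd hb u).trans_lt ?_
      rw [div_lt_iff₀ hr]
      linarith
    exact ((Metric.measure_ball_pos volume _ (by positivity)).trans_le (measure_mono hsub)).ne'
  have hTp : 0 < (volume (tangentBall C x R)).toReal := ENNReal.toReal_pos hT0 hT
  rw [le_div_iff₀ hTp, div_le_iff₀ hTp]
  constructor
  · have := ENNReal.toReal_mono hB hL
    rwa [ENNReal.toReal_mul, ENNReal.toReal_ofReal (by positivity)] at this
  · have := ENNReal.toReal_mono (ENNReal.mul_ne_top ENNReal.ofReal_ne_top hT) hU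
    rwa [ENNReal.toReal_mul, ENNReal.toReal_ofReal (by positivity)] at this
end
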